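/- arXiv:1406.2108 — 13 statements merged into one kernel-verified Lean document; each statement's English description precedes it below -/
import Mathlib

section
/- For all real numbers h and q with h > 1 and q > 4h, one has 1 − H_q(1 − 1/h) ≥ (ln q − ln h − 1)/(h · ln q). -/
/-- The `q`-ary entropy function: `H_q(p) = p·log_q((q−1)/p) + (1−p)·log_q(1/(1−p))`,
where `log_q x = ln x / ln q`. -/
noncomputable def qaryEntropy (q p : ℝ) : ℝ :=
  p * (Real.log ((q - 1) / p) / Real.log q) +
    (1 - p) * (Real.log (1 / (1 - p)) / Real.log q)

/-- For all real `h > 1` and `q > 4h`,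
`1 − H_q(1 − 1/h) ≥ (ln q − ln h − 1)/(h·ln q)`. -/
theorem entropy_lower_bound_small_h (h q : ℝ) (hh : h > 1) (hq : q > 4 * h) :
    1 - qaryEntropy q (1 - 1 / h) ≥
      (Real.log q - Real.log h - 1) / (h * Real.log q) := by
  have h0 : 0 < h := by linarith
  have h1 : 0 < h - 1 := by linarith
  have q1 : 0 < q - 1 := by linarith
  have hL : 0 < Real.log q := Real.log_pos (by linarith)
  have hmono : Real.log (q - 1) ≤ Real.log q := Real.log_le_log q1 (by linarith)
  have hlog : (h - 1) * (Real.log h - Real.log (h - 1)) ≤ 1 := by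
    have key := Real.log_le_sub_one_of_pos (div_pos h0 h1)
    rw [Real.log_div h0.ne' h1.ne'] at key
    calc (h - 1) * (Real.log h - Real.log (h - 1))
        ≤ (h - 1) * (h / (h - 1) - 1) := mul_le_mul_of_nonneg_left key h1.le
      _ = 1 := by field_simp; ring
  have hp : 1 - 1 / h = (h - 1) / h := by field_simp
  have hp' : 1 - (h - 1) / h = 1 / h := by field_simp; ring
  have hdiff : 1 - qaryEntropy q (1 - 1 / h) -
      (Real.log q - Real.log h - 1) / (h * Real.log q) =
      ((h - 1) * (Real.log q - Real.log (q - 1)) +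
        (1 - (h - 1) * (Real.log h - Real.log (h - 1)))) / (h * Real.log q) := by
    rw [qaryEntropy, hp, hp', one_div_one_div, Real.log_div q1.ne' (div_pos h1 h0).ne',
      Real.log_div h1.ne' h0.ne']
    field_simp
    ring
  rw [ge_iff_le, ← sub_nonneg, hdiff]
  exact div_nonneg (add_nonneg (mul_nonneg h1.le (sub_nonneg.2 hmono)) (sub_nonneg.2 hlog))
    (mul_pos h0 hL).le
end

section
/- For all real numbers h and q with q ≥ 8, 2 ≤ q/4 ≤ h, and h ≤ q − 1, one has 1 − H_q(1 − 1/h) ≥ (q − h)² / (4(q−1)² · h · ln q). -/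
/-- The second-order Taylor bound `-log (1 - x) ≥ x + x² / 2` on `[0, 1)`. -/
theorem add_sq_div_two_le_neg_log_one_sub {x : ℝ} (hx0 : 0 ≤ x) (hx1 : x < 1) :
    x + x ^ 2 / 2 ≤ -Real.log (1 - x) := by
  have hs := Real.hasSum_pow_div_log_of_abs_lt_one (abs_lt.2 ⟨by linarith, hx1⟩)
  have hle := sum_le_hasSum (Finset.range 2) (fun i _ => by positivity) hs
  norm_num [Finset.sum_range_succ] at hle
  linarith

/-- For all real `h, q` with `q ≥ 8`, `2 ≤ q/4 ≤ h` and `h ≤ q − 1`,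
`1 − H_q(1 − 1/h) ≥ (q − h)² / (4(q−1)²·h·ln q)`. -/
theorem entropy_lower_bound_large_h (h q : ℝ) (hq8 : q ≥ 8)
    (h24 : 2 ≤ q / 4) (hqh : q / 4 ≤ h) (hhq : h ≤ q - 1) :
    1 - qaryEntropy q (1 - 1 / h) ≥
      (q - h) ^ 2 / (4 * (q - 1) ^ 2 * h * Real.log q) := by
  have hq : 0 < q := by linarith
  have hq1 : 0 < q - 1 := by linarith
  have hh : 0 < h := by linarith
  have hh1 : 0 < h - 1 := by linarith
  have hlog : 0 < Real.log q := Real.log_pos (by linarith)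
  have hp : 1 - 1 / h = (h - 1) / h := by field_simp
  have hp0 : 0 < 1 - 1 / h := by rw [hp]; positivity
  have hfirst : (1 - 1 / h) * (Real.log ((q - 1) / (1 - 1 / h)) - Real.log q) ≤
      1 / h - 1 / q := by
    have hlog_le := Real.log_le_sub_one_of_pos (x := (q - 1) / (1 - 1 / h) / q) (by positivity)
    rw [Real.log_div (by positivity) hq.ne'] at hlog_le
    refine (mul_le_mul_of_nonneg_left hlog_le hp0.le).trans_eq ?_
    rw [hp]
    field_simp
    ring
  have hsecond : (1 - h / q) + (1 - h / q) ^ 2 / 2 ≤ Real.log q - Real.log h := by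
    have hle : h / q ≤ 1 := by rw [div_le_one hq]; linarith
    have hpos : 0 < h / q := by positivity
    have htaylor := add_sq_div_two_le_neg_log_one_sub (x := 1 - h / q) (by linarith) (by linarith)
    rw [sub_sub_cancel, Real.log_div hh.ne' hq.ne'] at htaylor
    linarith
  have hquad : (q - h) ^ 2 / (4 * (q - 1) ^ 2) ≤ (1 - h / q) ^ 2 / 2 := by
    have heq : (1 - h / q) ^ 2 / 2 = (q - h) ^ 2 / (2 * q ^ 2) := by field_simp
    rw [heq]
    exact div_le_div_of_nonneg_left (sq_nonneg _) (by positivity) (by nlinarith)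
  have hent : 1 - qaryEntropy q (1 - 1 / h) =
      (1 / h * (Real.log q - Real.log h) -
        (1 - 1 / h) * (Real.log ((q - 1) / (1 - 1 / h)) - Real.log q)) / Real.log q := by
    rw [qaryEntropy, sub_sub_cancel, one_div_one_div]
    field_simp
    ring
  have hrhs : (q - h) ^ 2 / (4 * (q - 1) ^ 2 * h * Real.log q) =
      (1 / h * ((q - h) ^ 2 / (4 * (q - 1) ^ 2))) / Real.log q := by
    field_simp
  rw [hent, hrhs, ge_iff_le]
  gcongr
  have hmul := mul_le_mul_of_nonneg_left ((add_le_add_right hquad (1 - h / q)).trans hsecond)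
    (one_div_pos.2 hh).le
  have hexpand : 1 / h * (1 - h / q + (q - h) ^ 2 / (4 * (q - 1) ^ 2)) =
      1 / h - 1 / q + 1 / h * ((q - h) ^ 2 / (4 * (q - 1) ^ 2)) := by
    field_simp
  linarith
end

section
/- Let q be a prime power, let h be a real number with 1 < h < q/4, let n be a positive integer, and set m = ⌈h·ln(q(n+1)) / (ln q − ln h − 1)⌉ and k = ⌈log(n+1)/log q⌉. Then there exists a k-dimensional linear subspace C of F_q^m in which every nonzero codeword has Hamming weight at least (1 − 1/h)·m; in particular C is an [m, k, (1−1/h)m]_q linear code containing at least n nonzero codewords. -/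
theorem card_mul_card_dotProduct_eq_zero {F ι : Type*} [Field F] [Fintype F] [DecidableEq F]
    [Fintype ι] [DecidableEq ι] {u : ι → F} (hu : u ≠ 0) :
    Fintype.card F * (Finset.univ.filter fun g : ι → F => u ⬝ᵥ g = 0).card =
      Fintype.card (ι → F) := by
  let f : (ι → F) →+ F := (dotProductBilin F F u).toAddMonoidHom
  have hf : ∀ g, f g = u ⬝ᵥ g := fun g => rfl
  have hsurj : Function.Surjective f := by
    obtain ⟨i, hi⟩ := Function.ne_iff.mp hu
    intro x
    refine ⟨Pi.single i ((u i)⁻¹ * x), ?_⟩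
    rw [hf, dotProduct_single, mul_inv_cancel_left₀ hi]
  have hker := AddSubgroup.card_mul_index f.ker
  rw [AddSubgroup.index_ker, AddMonoidHom.range_eq_top.mpr hsurj, AddSubgroup.card_top,
    Nat.card_eq_fintype_card, Nat.card_eq_fintype_card, Nat.card_eq_fintype_card] at hker
  rw [← hker, mul_comm, Fintype.card_subtype]
  congr 2
  ext g
  simp [AddMonoidHom.mem_ker, hf]

theorem sum_ite_dotProduct_eq_zero {F ι : Type*} [Field F] [Fintype F] [DecidableEq F]
    [Fintype ι] [DecidableEq ι] {u : ι → F} (hu : u ≠ 0) (a : ℝ) :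
    ∑ g : ι → F, (if u ⬝ᵥ g = 0 then a else 1) =
      Fintype.card (ι → F) * (1 + (a - 1) / Fintype.card F) := by
  have hq : (Fintype.card F : ℝ) ≠ 0 := by exact_mod_cast Fintype.card_ne_zero
  have hcard : (Fintype.card F : ℝ) * (Finset.univ.filter fun g : ι → F => u ⬝ᵥ g = 0).card =
      Fintype.card (ι → F) := by exact_mod_cast card_mul_card_dotProduct_eq_zero hu
  have hsplit : ∀ g : ι → F, (if u ⬝ᵥ g = 0 then a else 1) =
      1 + (if u ⬝ᵥ g = 0 then a - 1 else 0) := by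
    intro g; split_ifs <;> ring
  simp_rw [hsplit]
  rw [Finset.sum_add_distrib, ← Finset.sum_filter, Finset.sum_const, Finset.sum_const,
    Finset.card_univ, nsmul_eq_mul, nsmul_eq_mul, ← hcard]
  field_simp

/-- Chernoff-type counting bound over all generator matrices: if it is small enough, some matrix
encodes every nonzero message to a word with at most `t` zero coordinates. -/
theorem exists_matrix_forall_card_zeros_le {F ι κ : Type*} [Field F] [Fintype F] [DecidableEq F]
    [Fintype ι] [DecidableEq ι] [Fintype κ] [DecidableEq κ] {a t : ℝ} (ha : 1 ≤ a)
    (hlt : ((Fintype.card (ι → F) : ℝ) - 1) *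
      (1 + (a - 1) / Fintype.card F) ^ Fintype.card κ < a ^ t) :
    ∃ G : κ → ι → F, ∀ u : ι → F, u ≠ 0 →
      ((Finset.univ.filter fun i => u ⬝ᵥ G i = 0).card : ℝ) ≤ t := by
  by_contra! hbad
  have hprod : ∀ (G : κ → ι → F) (u : ι → F),
      ∏ i, (if u ⬝ᵥ G i = 0 then a else 1) =
        a ^ (Finset.univ.filter fun i => u ⬝ᵥ G i = 0).card := by
    intro G u
    rw [← Finset.prod_filter, Finset.prod_const]
  have hlower : ∀ G : κ → ι → F, a ^ t ≤
      ∑ u ∈ Finset.univ.erase (0 : ι → F), ∏ i, (if u ⬝ᵥ G i = 0 then a else 1) := by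
    intro G
    obtain ⟨u, hu, htu⟩ := hbad G
    calc a ^ t ≤ a ^ ((Finset.univ.filter fun i => u ⬝ᵥ G i = 0).card : ℝ) :=
          Real.rpow_le_rpow_of_exponent_le ha htu.le
      _ = ∏ i, (if u ⬝ᵥ G i = 0 then a else 1) := by rw [Real.rpow_natCast, hprod]
      _ ≤ _ := Finset.single_le_sum
          (f := fun u : ι → F => ∏ i, (if u ⬝ᵥ G i = 0 then a else 1))
          (fun v _ => by rw [hprod]; positivity) (by simp [hu])
  have hsum : ∀ u ∈ Finset.univ.erase (0 : ι → F),
      ∑ G : κ → ι → F, ∏ i, (if u ⬝ᵥ G i = 0 then a else 1) =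
        (Fintype.card (ι → F) * (1 + (a - 1) / Fintype.card F)) ^ Fintype.card κ := by
    intro u hu
    rw [← Fintype.prod_sum (fun (_ : κ) (g : ι → F) => if u ⬝ᵥ g = 0 then a else 1),
      Finset.prod_const, sum_ite_dotProduct_eq_zero (Finset.ne_of_mem_erase hu), Finset.card_univ]
  have htotal := Finset.sum_le_sum fun G (_ : G ∈ Finset.univ) => hlower G
  rw [Finset.sum_comm, Finset.sum_congr rfl hsum, Finset.sum_const, Finset.sum_const,
    Finset.card_erase_of_mem (Finset.mem_univ _), Finset.card_univ, Finset.card_univ,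
    nsmul_eq_mul, nsmul_eq_mul, Nat.cast_sub Fintype.card_pos, Fintype.card_fun (α := κ),
    mul_pow, Nat.cast_pow, Nat.cast_one, mul_left_comm] at htotal
  have hpos : (0 : ℝ) < (Fintype.card (ι → F) : ℝ) ^ Fintype.card κ := by
    have : 0 < Fintype.card (ι → F) := Fintype.card_pos
    positivity
  exact absurd (le_of_mul_le_mul_left htotal hpos) (not_le.mpr hlt)

/-- Let `q` be a prime power, `h` real with `1 < h < q/4`, `n` a positive integer,
`m = ⌈h·ln(q(n+1)) / (ln q − ln h − 1)⌉` and `k = ⌈log(n+1)/log q⌉`.  Then there is a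
`k`-dimensional linear subspace `C` of `F_q^m` in which every nonzero codeword has
Hamming weight at least `(1 − 1/h)·m`; in particular `C` is an `[m, k, (1−1/h)m]_q`
linear code containing at least `n` nonzero codewords. -/
theorem exists_linear_code_small_h (q n : ℕ) (hq : IsPrimePow q) (h : ℝ)
    (hh1 : 1 < h) (hh2 : h < (q : ℝ) / 4) (hn : 0 < n)
    (F : Type) [Field F] [Fintype F] [DecidableEq F] (hF : Fintype.card F = q)
    (m k : ℕ)
    (hm : m = ⌈h * Real.log (q * (n + 1)) / (Real.log q - Real.log h - 1)⌉₊)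
    (hk : k = ⌈Real.log (n + 1) / Real.log q⌉₊) :
    ∃ C : Submodule F (Fin m → F),
      Module.finrank F C = k ∧
      (∀ c ∈ C, c ≠ 0 → (1 - 1 / h) * m ≤ (hammingNorm c : ℝ)) ∧
      n ≤ Nat.card {c : C // (c : Fin m → F) ≠ 0} := by
  have hh0 : 0 < h := by linarith
  have hq4 : (4 : ℝ) < q := by linarith
  have hq0 : (0 : ℝ) < q := by linarith
  have hlogq : 0 < Real.log q := Real.log_pos (by linarith)
  have hn1 : (0 : ℝ) < n + 1 := by positivity
  have hqn : 1 < (q : ℝ) * (n + 1) := by nlinarith [(Nat.cast_nonneg n : (0 : ℝ) ≤ n)]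
  have hL : 0 < Real.log q - Real.log h - 1 := by
    rw [← Real.log_div hq0.ne' hh0.ne', sub_pos, Real.lt_log_iff_exp_lt (by positivity)]
    have : 4 < q / h := by rw [lt_div_iff₀ hh0]; linarith
    linarith [Real.exp_one_lt_d9]
  have hm_ge : Real.log (q * (n + 1)) ≤ m / h * (Real.log q - Real.log h - 1) := by
    have := Nat.le_ceil (h * Real.log (q * (n + 1)) / (Real.log q - Real.log h - 1))
    rw [← hm, div_le_iff₀ hL] at this
    rw [div_mul_eq_mul_div, le_div_iff₀ hh0]
    linarith
  have hm0 : (0 : ℝ) < m := by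
    have := Real.log_pos hqn
    rcases (Nat.cast_nonneg m : (0 : ℝ) ≤ m).eq_or_lt with h0 | h0
    · rw [← h0] at hm_ge; simp at hm_ge; linarith
    · exact h0
  have hk_lower : (n : ℝ) + 1 ≤ (q : ℝ) ^ k := by
    have := Nat.le_ceil (Real.log (n + 1) / Real.log q)
    rw [← hk, div_le_iff₀ hlogq, ← Real.log_pow] at this
    exact (Real.log_le_log_iff hn1 (by positivity)).mp this
  have hk_upper : (q : ℝ) ^ k ≤ q * (n + 1) := by
    have hnn : 0 ≤ Real.log (n + 1) / Real.log q :=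
      div_nonneg (Real.log_nonneg (by linarith [(Nat.cast_nonneg n : (0 : ℝ) ≤ n)])) hlogq.le
    have := Nat.ceil_lt_add_one hnn
    rw [← hk, div_add_one hlogq.ne', lt_div_iff₀ hlogq, ← Real.log_pow, add_comm,
      ← Real.log_mul hq0.ne' hn1.ne'] at this
    exact ((Real.log_lt_log_iff (by positivity) (by positivity)).mp this).le
  have ha : 1 ≤ (q : ℝ) / h := by rw [le_div_iff₀ hh0]; linarith
  have hbound : ((Fintype.card (Fin k → F) : ℝ) - 1) *
      (1 + (q / h - 1) / Fintype.card F) ^ Fintype.card (Fin m) < ((q : ℝ) / h) ^ ((m : ℝ) / h) := by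
    rw [Fintype.card_fun, Fintype.card_fin, Fintype.card_fin, hF, Nat.cast_pow]
    have hmgf : (1 + ((q : ℝ) / h - 1) / q) ^ m ≤ Real.exp (m / h) := by
      calc (1 + ((q : ℝ) / h - 1) / q) ^ m ≤ (Real.exp (1 / h)) ^ m := by
            refine pow_le_pow_left₀ (by have := div_nonneg (sub_nonneg.mpr ha) hq0.le; linarith) ?_ m
            have h1 : ((q : ℝ) / h - 1) / q ≤ 1 / h := by
              rw [div_le_iff₀ hq0, div_mul_eq_mul_div, one_mul]; linarith
            linarith [Real.add_one_le_exp (1 / h)]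
        _ = Real.exp (m / h) := by rw [← Real.exp_nat_mul, mul_one_div]
    calc ((q : ℝ) ^ k - 1) * (1 + ((q : ℝ) / h - 1) / q) ^ m
        ≤ ((q : ℝ) ^ k - 1) * Real.exp (m / h) := by
          refine mul_le_mul_of_nonneg_left hmgf ?_
          linarith [(Nat.cast_nonneg n : (0 : ℝ) ≤ n)]
      _ < (q * (n + 1)) * Real.exp (m / h) := by
          gcongr; linarith
      _ ≤ Real.exp (m / h * (Real.log q - Real.log h - 1)) * Real.exp (m / h) := by
          gcongr
          rw [← Real.log_le_iff_le_exp (by positivity)]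
          exact hm_ge
      _ = ((q : ℝ) / h) ^ ((m : ℝ) / h) := by
          rw [← Real.exp_add, Real.rpow_def_of_pos (by positivity),
            Real.log_div hq0.ne' hh0.ne']
          ring_nf
  obtain ⟨G, hG⟩ := exists_matrix_forall_card_zeros_le ha hbound
  let E : (Fin k → F) →ₗ[F] (Fin m → F) := LinearMap.pi fun i => (dotProductBilin F F).flip (G i)
  have hE : ∀ u i, E u i = u ⬝ᵥ G i := fun u i => rfl
  have hweight : ∀ u, u ≠ 0 → (1 - 1 / h) * m ≤ (hammingNorm (E u) : ℝ) := by
    intro u hu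
    have hsum : (Finset.univ.filter fun i => u ⬝ᵥ G i = 0).card + hammingNorm (E u) = m := by
      simpa [hammingNorm, hE] using Finset.card_filter_add_card_filter_not
        (s := (Finset.univ : Finset (Fin m))) (fun i => u ⬝ᵥ G i = 0)
    have hsum' : ((Finset.univ.filter fun i => u ⬝ᵥ G i = 0).card : ℝ) + hammingNorm (E u) = m := by
      exact_mod_cast hsum
    have := hG u hu
    rw [sub_mul, one_mul, one_div_mul_eq_div]
    linarith
  have hinj : Function.Injective E := by
    rw [injective_iff_map_eq_zero]
    intro u hu
    by_contra hne
    have h1 := hweight u hne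
    rw [hu, hammingNorm_zero, Nat.cast_zero] at h1
    have h2 : 0 < 1 - 1 / h := by rw [sub_pos, div_lt_one hh0]; exact hh1
    linarith [mul_pos h2 hm0]
  have hrank : Module.finrank F (LinearMap.range E) = k := by
    rw [LinearMap.finrank_range_of_inj hinj, Module.finrank_fin_fun]
  refine ⟨LinearMap.range E, hrank, ?_, ?_⟩
  · rintro _ ⟨u, rfl⟩ hne
    exact hweight u fun hu => hne (by rw [hu, map_zero])
  · classical
    have hcard : Nat.card (LinearMap.range E) = q ^ k := by
      rw [Module.natCard_eq_pow_finrank (K := F), hrank, Nat.card_eq_fintype_card, hF]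
    have hk' : n + 1 ≤ q ^ k := by exact_mod_cast hk_lower
    have hnz : Nat.card {c : LinearMap.range E // (c : Fin m → F) ≠ 0} = q ^ k - 1 := by
      rw [← hcard, Nat.card_eq_fintype_card, Nat.card_eq_fintype_card]
      simp
    omega
end

section
/- Let q be a prime power, let h be a real number with 2 ≤ q/4 ≤ h ≤ q − 1, let n be a positive integer, and set m = ⌈4(q−1)²·h·ln(q(n+1)) / (q−h)²⌉ and k = ⌈log(n+1)/log q⌉. Then there exists a k-dimensional linear subspace C of F_q^m in which every nonzero codeword has Hamming weight at least (1 − 1/h)·m; in particular C is an [m, k, (1−1/h)m]_q linear code containing at least n nonzero codewords. -/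
open Finset in
/-- Over a finite field, a nonzero vector is orthogonal to exactly a `1/q` fraction of vectors. -/
theorem card_dotProduct_eq_zero_mul_card {F ι : Type*} [Field F] [Fintype F] [DecidableEq F]
    [Fintype ι] [DecidableEq ι] {u : ι → F} (hu : u ≠ 0) :
    #{g : ι → F | g ⬝ᵥ u = 0} * Fintype.card F = Fintype.card F ^ Fintype.card ι := by
  let f : Module.Dual F (ι → F) :=
    { toFun := fun g => g ⬝ᵥ u
      map_add' := fun a b => add_dotProduct a b u
      map_smul' := fun c a => smul_dotProduct c a u }
  have hf : f ≠ 0 := by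
    intro h0
    apply hu
    ext i
    simpa [f] using LinearMap.congr_fun h0 (Pi.single i 1)
  have h1 := Module.Dual.finrank_ker_add_one_of_ne_zero hf
  have h2 : #{g : ι → F | g ⬝ᵥ u = 0} = Nat.card (LinearMap.ker f) :=
    (Nat.subtype_card _ fun g => by simp [f]).symm
  rw [h2, Module.natCard_eq_pow_finrank (K := F), Nat.card_eq_fintype_card, ← pow_succ, h1,
    Module.finrank_fintype_fun_eq_card]

open Finset in
/-- The moment generating function of the number of vanishing coordinates of `G *ᵥ u` for a
uniformly random matrix `G`. -/
theorem sum_pow_card_mulVec_eq_zero {F ι κ : Type*} [Field F] [Fintype F] [DecidableEq F]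
    [Fintype ι] [DecidableEq ι] [Fintype κ] [DecidableEq κ] {u : ι → F} (hu : u ≠ 0) (x : ℝ) :
    ∑ G : κ → ι → F, x ^ #{i | Matrix.mulVec G u i = 0} =
      ((Fintype.card F : ℝ) ^ Fintype.card ι * (1 + (x - 1) / Fintype.card F)) ^
        Fintype.card κ := by
  have hq : (Fintype.card F : ℝ) ≠ 0 := by simp
  have hrow : ∑ g : ι → F, (if g ⬝ᵥ u = 0 then x else 1) =
      (Fintype.card F : ℝ) ^ Fintype.card ι * (1 + (x - 1) / Fintype.card F) := by
    have h1 : ((#{g : ι → F | g ⬝ᵥ u = 0} : ℕ) : ℝ) * Fintype.card F =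
        (Fintype.card F : ℝ) ^ Fintype.card ι := by
      exact_mod_cast card_dotProduct_eq_zero_mul_card hu
    have h2 : ∀ g : ι → F, (if g ⬝ᵥ u = 0 then x else 1) =
        1 + (x - 1) * (if g ⬝ᵥ u = 0 then 1 else 0) := by
      intro g
      split_ifs <;> ring
    simp_rw [h2, sum_add_distrib, ← mul_sum, sum_boole]
    simp only [sum_const, card_univ, Fintype.card_fun, nsmul_eq_mul, mul_one, Nat.cast_pow]
    rw [mul_add, mul_one, ← h1]
    field_simp
  calc ∑ G : κ → ι → F, x ^ #{i | Matrix.mulVec G u i = 0}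
      = ∑ G : κ → ι → F, ∏ i, (if G i ⬝ᵥ u = 0 then x else 1) := by
        refine sum_congr rfl fun G _ => ?_
        rw [prod_ite]
        simp only [Matrix.mulVec, prod_const, one_pow, mul_one]
        rfl
    _ = ∏ _i : κ, ∑ g : ι → F, (if g ⬝ᵥ u = 0 then x else 1) := by
        rw [Fintype.prod_sum]
    _ = _ := by rw [hrow, prod_const, card_univ]

open Finset in
/-- The union bound: if the expected total exponential moment is below `B`, some matrix `G` keeps
each of the moments below `B`. -/
theorem exists_forall_pow_card_mulVec_eq_zero_lt {F ι κ : Type*} [Field F] [Fintype F]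
    [DecidableEq F] [Fintype ι] [DecidableEq ι] [Fintype κ] [DecidableEq κ] {x B : ℝ}
    (hx : 0 ≤ x)
    (hB : ((Fintype.card F : ℝ) ^ Fintype.card ι - 1) *
      (1 + (x - 1) / Fintype.card F) ^ Fintype.card κ < B) :
    ∃ G : Matrix κ ι F, ∀ u : ι → F, u ≠ 0 → x ^ #{i | Matrix.mulVec G u i = 0} < B := by
  by_contra! hbad
  have hq : 0 < (Fintype.card F : ℝ) := by simp [Fintype.card_pos]
  set N : ℝ := (Fintype.card F : ℝ) ^ Fintype.card ι with hN
  have hNpos : 0 < N := by positivity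
  have hlow : N ^ Fintype.card κ * B ≤
      ∑ G : κ → ι → F, ∑ u ∈ univ.erase (0 : ι → F), x ^ #{i | Matrix.mulVec G u i = 0} := by
    calc N ^ Fintype.card κ * B = ∑ _G : κ → ι → F, B := by
          simp [hN]
      _ ≤ _ := by
          refine sum_le_sum fun G _ => ?_
          obtain ⟨u, hu, hle⟩ := hbad G
          exact hle.trans (single_le_sum
            (f := fun u : ι → F => x ^ #{i | Matrix.mulVec G u i = 0})
            (fun v _ => pow_nonneg hx _) (by simpa using hu))
  rw [sum_comm, sum_congr rfl fun u hu => sum_pow_card_mulVec_eq_zero (ne_of_mem_erase hu) x,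
    sum_const, nsmul_eq_mul, card_erase_of_mem (mem_univ _), card_univ, Fintype.card_fun,
    Nat.cast_pred (by positivity), Nat.cast_pow, ← hN, mul_pow] at hlow
  have h3 : N ^ Fintype.card κ * B ≤ N ^ Fintype.card κ *
      ((N - 1) * (1 + (x - 1) / Fintype.card F) ^ Fintype.card κ) := by linarith
  exact absurd (le_of_mul_le_mul_left h3 (by positivity)) (not_le.mpr hB)

theorem sq_div_two_mul_le_mul_log_sub_add {x : ℝ} (hx : 1 ≤ x) :
    (x - 1) ^ 2 / (2 * x) ≤ x * Real.log x - x + 1 := by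
  have hx0 : 0 < x := by linarith
  have ht : 0 ≤ 1 - x⁻¹ := by
    have := inv_le_one_of_one_le₀ hx
    linarith
  have ht1 : |1 - x⁻¹| < 1 := by
    have := inv_pos.mpr hx0
    rw [abs_of_nonneg ht]
    linarith
  have hs := Real.hasSum_pow_div_log_of_abs_lt_one ht1
  have h2 := sum_le_hasSum (Finset.range 2) (fun i _ => by positivity) hs
  have e : -Real.log (1 - (1 - x⁻¹)) = Real.log x := by
    rw [sub_sub_cancel, Real.log_inv, neg_neg]
  rw [e] at h2
  simp only [Finset.sum_range_succ, Finset.sum_range_zero] at h2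
  norm_num at h2
  have h3 := mul_le_mul_of_nonneg_left h2 hx0.le
  have e2 : x * (1 - x⁻¹ + (1 - x⁻¹) ^ 2 / 2) = (x - 1) + (x - 1) ^ 2 / (2 * x) := by
    field_simp
  linarith

/-- The Chernoff estimate for `m` trials of success probability `1 / q` at threshold `m / h`. -/
theorem mul_one_add_pow_le_rpow {q h L : ℝ} {m : ℕ} (hq : 8 ≤ q) (hh : 0 < h) (hhq : h < q)
    (hL : 0 ≤ L) (hm : 4 * (q - 1) ^ 2 * h * L / (q - h) ^ 2 ≤ m) :
    Real.exp L * (1 + (q / h - 1) / q) ^ m ≤ (q / h) ^ ((m : ℝ) / h) := by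
  have hq0 : 0 < q := by linarith
  have hx1 : 1 ≤ q / h := (one_le_div hh).mpr hhq.le
  have hx0 : 0 < q / h := by positivity
  have hd : 0 < q - h := by linarith
  have hnn : 0 ≤ (q / h - 1) / q := div_nonneg (by linarith) hq0.le
  have h1 : (1 + (q / h - 1) / q) ^ m ≤ Real.exp (m * ((q / h - 1) / q)) := by
    rw [Real.exp_nat_mul]
    refine pow_le_pow_left₀ (by linarith) ?_ m
    linarith [Real.add_one_le_exp ((q / h - 1) / q)]
  have hpoi := sq_div_two_mul_le_mul_log_sub_add hx1
  have hkey : L ≤ m * ((q / h - 1) ^ 2 / (2 * (q / h)) / q) := by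
    have e : (q / h - 1) ^ 2 / (2 * (q / h)) / q = (q - h) ^ 2 / (2 * q ^ 2 * h) := by
      field_simp
    rw [e]
    refine le_trans ?_ (mul_le_mul_of_nonneg_right hm (by positivity))
    have e2 : 4 * (q - 1) ^ 2 * h * L / (q - h) ^ 2 * ((q - h) ^ 2 / (2 * q ^ 2 * h)) =
        L * (2 * (q - 1) ^ 2 / q ^ 2) := by
      field_simp
      ring
    rw [e2]
    refine le_mul_of_one_le_right hL ?_
    rw [one_le_div (by positivity)]
    nlinarith
  have hexp : L + m * ((q / h - 1) / q) ≤ Real.log (q / h) * (m / h) := by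
    have h4 : (m : ℝ) * ((q / h - 1) ^ 2 / (2 * (q / h)) / q) ≤
        m * ((q / h * Real.log (q / h) - q / h + 1) / q) := by gcongr
    have e3 : (m : ℝ) * ((q / h * Real.log (q / h) - q / h + 1) / q) =
        Real.log (q / h) * (m / h) - m * ((q / h - 1) / q) := by
      field_simp
      ring
    linarith
  calc Real.exp L * (1 + (q / h - 1) / q) ^ m
      ≤ Real.exp L * Real.exp (m * ((q / h - 1) / q)) := by gcongr
    _ = Real.exp (L + m * ((q / h - 1) / q)) := (Real.exp_add _ _).symm
    _ ≤ Real.exp (Real.log (q / h) * (m / h)) := Real.exp_le_exp.mpr hexp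
    _ = _ := (Real.rpow_def_of_pos hx0 _).symm

theorem card_eq_zero_add_hammingNorm {F : Type*} [Zero F] [DecidableEq F] {κ : Type*}
    [Fintype κ] (c : κ → F) :
    (Finset.univ.filter fun i => c i = 0).card + hammingNorm c = Fintype.card κ := by
  rw [hammingNorm, Finset.card_filter_add_card_filter_not, Finset.card_univ]

/-- Let `q` be a prime power, `h` real with `2 ≤ q/4 ≤ h ≤ q − 1`, `n` a positive
integer, `m = ⌈4(q−1)²·h·ln(q(n+1)) / (q−h)²⌉` and `k = ⌈log(n+1)/log q⌉`.  Then there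
is a `k`-dimensional linear subspace `C` of `F_q^m` in which every nonzero codeword has
Hamming weight at least `(1 − 1/h)·m`; in particular `C` is an `[m, k, (1−1/h)m]_q`
linear code containing at least `n` nonzero codewords. -/
theorem exists_linear_code_large_h (q n : ℕ) (hq : IsPrimePow q) (h : ℝ)
    (h24 : 2 ≤ (q : ℝ) / 4) (hqh : (q : ℝ) / 4 ≤ h) (hhq : h ≤ (q : ℝ) - 1)
    (hn : 0 < n)
    (F : Type) [Field F] [Fintype F] [DecidableEq F] (hF : Fintype.card F = q)
    (m k : ℕ)
    (hm : m = ⌈4 * ((q : ℝ) - 1) ^ 2 * h * Real.log (q * (n + 1)) / ((q : ℝ) - h) ^ 2⌉₊)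
    (hk : k = ⌈Real.log (n + 1) / Real.log q⌉₊) :
    ∃ C : Submodule F (Fin m → F),
      Module.finrank F C = k ∧
      (∀ c ∈ C, c ≠ 0 → (1 - 1 / h) * m ≤ (hammingNorm c : ℝ)) ∧
      n ≤ Nat.card {c : C // (c : Fin m → F) ≠ 0} := by
  have hq8 : (8 : ℝ) ≤ q := by linarith
  have hq0 : (0 : ℝ) < q := by linarith
  have hh : 2 ≤ h := by linarith
  have hh0 : 0 < h := by linarith
  have hlogq : 0 < Real.log q := Real.log_pos (by linarith)
  have hn1 : (0 : ℝ) < n + 1 := by positivity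
  have hprod : 1 < (q : ℝ) * (n + 1) := by nlinarith [(Nat.cast_nonneg n : (0 : ℝ) ≤ n)]
  have hL : 0 < Real.log (q * (n + 1)) := Real.log_pos hprod
  have hd : 0 < (q : ℝ) - h := by linarith
  have hm_le : 4 * ((q : ℝ) - 1) ^ 2 * h * Real.log (q * (n + 1)) / ((q : ℝ) - h) ^ 2 ≤ m :=
    hm ▸ Nat.le_ceil _
  have hm0 : (0 : ℝ) < m := by
    have hq1 : (0 : ℝ) < q - 1 := by linarith
    refine lt_of_lt_of_le ?_ hm_le
    positivity
  have hk_ge : (n : ℝ) + 1 ≤ (q : ℝ) ^ k := by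
    have h1 : Real.log (n + 1) / Real.log q ≤ k := hk ▸ Nat.le_ceil _
    rw [div_le_iff₀ hlogq, ← Real.log_pow] at h1
    exact (Real.log_le_log_iff hn1 (by positivity)).mp h1
  have hk_lt : (q : ℝ) ^ k < q * (n + 1) := by
    have h1 : (k : ℝ) < Real.log (n + 1) / Real.log q + 1 := by
      rw [hk]
      exact Nat.ceil_lt_add_one
        (div_nonneg (Real.log_nonneg (by linarith [(Nat.cast_nonneg n : (0 : ℝ) ≤ n)])) hlogq.le)
    rw [← sub_lt_iff_lt_add, lt_div_iff₀ hlogq] at h1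
    rw [← Real.log_lt_log_iff (by positivity) (by positivity), Real.log_pow,
      Real.log_mul hq0.ne' hn1.ne']
    linarith
  have hx1 : 1 < (q : ℝ) / h := (one_lt_div hh0).mpr (by linarith)
  have hchernoff := mul_one_add_pow_le_rpow hq8 hh0 (by linarith) hL.le hm_le
  rw [Real.exp_log (by linarith)] at hchernoff
  obtain ⟨G, hG⟩ := exists_forall_pow_card_mulVec_eq_zero_lt (F := F) (ι := Fin k) (κ := Fin m)
    (x := q / h) (B := (q / h) ^ ((m : ℝ) / h)) (by positivity) (by
      rw [hF, Fintype.card_fin, Fintype.card_fin]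
      refine lt_of_lt_of_le (mul_lt_mul_of_pos_right (by linarith) (pow_pos ?_ m)) hchernoff
      have : 0 ≤ ((q : ℝ) / h - 1) / q := div_nonneg (by linarith) hq0.le
      linarith)
  have hweight : ∀ u, u ≠ 0 → (1 - 1 / h) * m < (hammingNorm (G.mulVec u) : ℝ) := by
    intro u hu
    have h1 := hG u hu
    rw [← Real.rpow_natCast, Real.rpow_lt_rpow_left_iff hx1] at h1
    have h2 := congrArg (Nat.cast : ℕ → ℝ) (card_eq_zero_add_hammingNorm (G.mulVec u))
    rw [Fintype.card_fin, Nat.cast_add] at h2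
    have e : (1 - 1 / h) * (m : ℝ) = m - m / h := by ring
    linarith
  have hinj : Function.Injective G.mulVecLin := by
    rw [← LinearMap.ker_eq_bot, LinearMap.ker_eq_bot']
    intro u hu0
    by_contra hu
    have h1 := hweight u hu
    rw [← Matrix.mulVecLin_apply, hu0, hammingNorm_zero, Nat.cast_zero] at h1
    have h2 : 1 / h ≤ 1 := (div_le_one hh0).mpr (by linarith)
    nlinarith
  have hrank : Module.finrank F (LinearMap.range G.mulVecLin) = k := by
    rw [LinearMap.finrank_range_of_inj hinj, Module.finrank_fin_fun]
  refine ⟨LinearMap.range G.mulVecLin, hrank, ?_, ?_⟩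
  · rintro _ ⟨u, rfl⟩ hne
    refine (hweight u ?_).le
    rintro rfl
    exact hne (map_zero _)
  · have hcard : Nat.card (LinearMap.range G.mulVecLin) = q ^ k := by
      rw [Module.natCard_eq_pow_finrank (K := F), hrank, Nat.card_eq_fintype_card, hF]
    have hcompl : Nat.card {c : LinearMap.range G.mulVecLin // (c : Fin m → F) ≠ 0} = q ^ k - 1 := by
      classical
      rw [← hcard, Nat.card_eq_fintype_card, Nat.card_eq_fintype_card]
      simp only [ne_eq, ZeroMemClass.coe_eq_zero]
      rw [Fintype.card_subtype_compl, Fintype.card_subtype_eq]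
    have : n + 1 ≤ q ^ k := by exact_mod_cast hk_ge
    omega
end

section
/- Let q be a prime power and d, n positive integers with n > q, n > d, and q > 4(d+1). Then there exists a hitting set A for H_d over F_q of size at most m = ⌈(d+1)·log(q(n+1)) / log(q/(e(d+1)))⌉. -/
open Finset in
/-- The words over the alphabet `F` that agree with `c` on `S` number `|F| ^ (m - |S|)`. -/
theorem card_filter_agree_on {F : Type*} [Fintype F] [DecidableEq F] {m : ℕ}
    (c : Fin m → F) (S : Finset (Fin m)) :
    #{w : Fin m → F | ∀ j ∈ S, w j = c j} = Fintype.card F ^ (m - #S) := by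
  have h : ({w : Fin m → F | ∀ j ∈ S, w j = c j} : Finset (Fin m → F)) =
      Fintype.piFinset (fun j => if j ∈ S then {c j} else univ) := by
    ext w
    simp only [mem_filter, mem_univ, true_and, Fintype.mem_piFinset]
    refine forall_congr' fun j => ?_
    by_cases hj : j ∈ S <;> simp [hj]
  rw [h, Fintype.card_piFinset]
  simp only [apply_ite Finset.card, card_singleton, card_univ]
  rw [prod_ite, prod_const_one, one_mul, prod_const, filter_not, card_sdiff]
  simp

open Finset in
/-- The words agreeing with `c` in at least `t` positions number at most
`(m.choose t) * |F| ^ (m - t)`. -/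
theorem card_filter_le_card_agree {F : Type*} [Fintype F] [DecidableEq F] {m : ℕ}
    (c : Fin m → F) (t : ℕ) :
    #{w : Fin m → F | t ≤ #{j | w j = c j}} ≤ m.choose t * Fintype.card F ^ (m - t) := by
  have h : ({w : Fin m → F | t ≤ #{j | w j = c j}} : Finset (Fin m → F)) ⊆
      (powersetCard t univ).biUnion
        fun S => {w : Fin m → F | ∀ j ∈ S, w j = c j} := by
    intro w hw
    obtain ⟨S, hS, hSt⟩ := exists_subset_card_eq (mem_filter.1 hw).2
    simp only [mem_biUnion, mem_powersetCard_univ, mem_filter, mem_univ, true_and]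
    exact ⟨S, hSt, fun j hj => (mem_filter.1 (hS hj)).2⟩
  refine (card_le_card h).trans
    ((card_biUnion_le_card_mul _ _ (Fintype.card F ^ (m - t)) ?_).trans_eq ?_)
  · intro S hS
    rw [card_filter_agree_on, (mem_powersetCard.1 hS).2]
  · simp

open Finset in
/-- Gilbert–Varshamov bound: there are `n` words of length `m`, any two of which agree in
fewer than `t` positions, as soon as `n * m.choose t < |F| ^ t`. -/
theorem exists_code_card_agree_lt {F : Type*} [Fintype F] [Nonempty F] [DecidableEq F] {m t : ℕ}
    (htm : t ≤ m) (n : ℕ) (h : n * m.choose t < Fintype.card F ^ t) :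
    ∃ c : Fin n → Fin m → F, ∀ i k, i ≠ k → #{j | c i j = c k j} < t := by
  induction n with
  | zero => exact ⟨fun i => i.elim0, fun i => i.elim0⟩
  | succ n ih =>
    have hn : n * m.choose t < Fintype.card F ^ t :=
      (Nat.mul_le_mul_right _ n.le_succ).trans_lt h
    obtain ⟨c, hc⟩ := ih hn
    obtain ⟨w, hw⟩ : ∃ w : Fin m → F, ∀ i, #{j | w j = c i j} < t := by
      by_contra! hall
      have hcov : (univ : Finset (Fin m → F)) ⊆
          (univ : Finset (Fin n)).biUnion
            fun i => {w : Fin m → F | t ≤ #{j | w j = c i j}} := by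
        intro w _
        simpa using hall w
      have hcard := (card_le_card hcov).trans
        (card_biUnion_le_card_mul _ _ _ fun i _ => card_filter_le_card_agree (c i) t)
      simp only [card_univ, Fintype.card_fun, Fintype.card_fin] at hcard
      have hF : 0 < Fintype.card F ^ (m - t) := by
        simp [Fintype.card_pos]
      have := Nat.mul_lt_mul_of_pos_right hn hF
      rw [← pow_add, Nat.add_sub_cancel' htm, mul_assoc] at this
      exact absurd hcard this.not_ge
    refine ⟨Fin.cons w c, fun i k => ?_⟩
    refine Fin.cases ?_ (fun i => ?_) i <;> refine Fin.cases ?_ (fun k => ?_) k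
    · exact fun h => absurd rfl h
    · intro _
      simpa using hw k
    · intro _
      simpa [eq_comm] using hw i
    · intro hik
      simpa using hc i k fun h => hik (congrArg Fin.succ h)

/-- If `m ≤ d * t` then `m.choose t ≤ (e * d) ^ t`. -/
theorem choose_le_exp_one_mul_pow {m d t : ℕ} (ht : 0 < t) (h : m ≤ d * t) :
    (m.choose t : ℝ) ≤ (Real.exp 1 * d) ^ t := by
  have hfac : (0 : ℝ) < t.factorial := by exact_mod_cast t.factorial_pos
  calc (m.choose t : ℝ) ≤ (m : ℝ) ^ t / t.factorial := Nat.choose_le_pow_div t m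
    _ ≤ ((d : ℝ) * t) ^ t / t.factorial := by
      gcongr
      exact_mod_cast h
    _ = (d : ℝ) ^ t * ((t : ℝ) ^ t / t.factorial) := by rw [mul_pow, mul_div_assoc]
    _ ≤ (d : ℝ) ^ t * Real.exp t := by
      gcongr
      exact Real.pow_div_factorial_le_exp _ (by positivity) t
    _ = (Real.exp 1 * d) ^ t := by rw [mul_pow, ← Real.exp_nat_mul, mul_one, mul_comm]

open Finset in
/-- The coordinates of a code of `n` words of length `m`, any two of which agree in fewer than `t`
positions, form a hitting set for `d` pairs if `d * (t - 1) < m`. -/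
theorem exists_hitting_set_of_code {F : Type*} [DecidableEq F] {n m d t : ℕ}
    (hm : d * (t - 1) < m) (c : Fin n → Fin m → F)
    (hc : ∀ i k, i ≠ k → #{j | c i j = c k j} < t) :
    ∃ A : Finset (Fin n → F), #A ≤ m ∧
      ∀ I : Finset (Fin n × Fin n), #I ≤ d → (∀ p ∈ I, p.1 ≠ p.2) →
        ∃ a ∈ A, ∀ p ∈ I, a p.1 ≠ a p.2 := by
  refine ⟨univ.image fun j i => c i j, card_image_le.trans_eq (by simp), fun I hI hne => ?_⟩
  by_contra! hall
  have hcov : (univ : Finset (Fin m)) ⊆ I.biUnion fun p => {j | c p.1 j = c p.2 j} := by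
    intro j _
    simpa using hall _ (mem_image_of_mem _ (mem_univ j))
  have hcard := (card_le_card hcov).trans
    (card_biUnion_le_card_mul _ _ (t - 1) fun p hp => Nat.le_sub_one_of_lt (hc _ _ (hne p hp)))
  rw [card_univ, Fintype.card_fin] at hcard
  exact absurd (hcard.trans (Nat.mul_le_mul_right _ hI)) hm.not_ge

/-- Let `q` be a prime power and `d, n` positive integers with `n > q`, `n > d` and
`q > 4(d+1)`.  Then there exists a hitting set `A` for `H_d` over `F_q` of size at most
`⌈(d+1)·log(q(n+1)) / log(q/(e(d+1)))⌉`.  A hitting set for `H_d` is a finite set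
`A ⊆ F_q^n` such that for every `I ⊆ [n]×[n]` with `|I| ≤ d` and `i₁ ≠ i₂` for every
`(i₁,i₂) ∈ I`, there is `a ∈ A` with `a_{i₁} ≠ a_{i₂}` for all `(i₁,i₂) ∈ I`
(equivalently, `A` hits every nonzero polynomial `∏_{(i₁,i₂)∈I}(x_{i₁} − x_{i₂})`). -/
theorem exists_hitting_set_large_q (q d n : ℕ) (hq : IsPrimePow q)
    (hd : 0 < d) (hn : 0 < n) (hnq : n > q) (hnd : n > d) (hqd : q > 4 * (d + 1))
    (F : Type) [Field F] [Fintype F] (hF : Fintype.card F = q) :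
    ∃ A : Finset (Fin n → F),
      A.card ≤
        ⌈((d : ℝ) + 1) * Real.log (q * (n + 1)) /
          Real.log (q / (Real.exp 1 * ((d : ℝ) + 1)))⌉₊ ∧
      ∀ I : Finset (Fin n × Fin n), I.card ≤ d → (∀ p ∈ I, p.1 ≠ p.2) →
        ∃ a ∈ A, ∀ p ∈ I, a p.1 ≠ a p.2 := by
  classical
  set L := Real.log (q / (Real.exp 1 * ((d : ℝ) + 1))) with hL
  set m := ⌈((d : ℝ) + 1) * Real.log (q * (n + 1)) / L⌉₊ with hm
  have hd' : (0 : ℝ) < d := by exact_mod_cast hd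
  have hn' : (0 : ℝ) < n := by exact_mod_cast hn
  have hq' : 4 * ((d : ℝ) + 1) < q := by exact_mod_cast hqd
  have he : Real.exp 1 < 4 := Real.exp_one_lt_d9.trans (by norm_num)
  have hq0 : (0 : ℝ) < q := by linarith
  have hLpos : 0 < L := by
    refine Real.log_pos ((one_lt_div (by positivity)).2 (lt_of_le_of_lt ?_ hq'))
    gcongr
  have hlog : Real.log n < Real.log (q * (n + 1)) := by
    refine Real.log_lt_log hn' ?_
    nlinarith
  have hlogn : 0 ≤ Real.log n := Real.log_natCast_nonneg n
  have hmL : ((d : ℝ) + 1) * Real.log (q * (n + 1)) ≤ m * L :=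
    (div_le_iff₀ hLpos).1 (Nat.le_ceil _)
  have hm0 : 0 < m := Nat.ceil_pos.2
    (div_pos (mul_pos (by positivity) (hlogn.trans_lt hlog)) hLpos)
  set t := (m - 1) / d + 1 with ht
  have hmt : m ≤ d * t := by
    have := Nat.lt_mul_div_succ (m - 1) hd
    rw [← ht] at this
    omega
  have hdt : d * (t - 1) < m := by
    have := Nat.mul_div_le (m - 1) d
    rw [ht, Nat.add_sub_cancel]
    omega
  have htm : t ≤ m := by
    have := Nat.div_le_self (m - 1) d
    omega
  have hmt' : (m : ℝ) ≤ d * t := by exact_mod_cast hmt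
  have hnt : Real.log n < t * L := by
    have h1 : (d : ℝ) * Real.log n < d * (t * L) := by nlinarith
    exact lt_of_mul_lt_mul_left h1 hd'.le
  have hpow : (n : ℝ) < (q / (Real.exp 1 * d)) ^ t := by
    refine (Real.lt_pow_of_log_lt (by positivity) hnt).trans_le ?_
    gcongr
    linarith
  have hgv : n * m.choose t < Fintype.card F ^ t := by
    rw [hF]
    have h2 : (n : ℝ) * m.choose t < (q : ℝ) ^ t :=
      calc (n : ℝ) * m.choose t ≤ n * (Real.exp 1 * d) ^ t := by
            gcongr
            exact choose_le_exp_one_mul_pow (Nat.succ_pos _) hmt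
        _ < (q / (Real.exp 1 * d)) ^ t * (Real.exp 1 * d) ^ t := by gcongr
        _ = (q : ℝ) ^ t := by rw [← mul_pow, div_mul_cancel₀ _ (by positivity)]
    exact_mod_cast h2
  obtain ⟨c, hc⟩ := exists_code_card_agree_lt htm n hgv
  exact exists_hitting_set_of_code hdt c hc
end

section
/- Let q be a prime power and d, n positive integers with n > q, n > d, and d + 2 ≤ q ≤ 4(d+1). Then there exists a hitting set A for H_d over F_q of size at most m = ⌈4(q−1)²·(d+1)·ln(q(n+1)) / (q−d−1)²⌉. -/
/-- Union bound over `m` independent uniform samples: if each `s : S` rejects at most a fraction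
`d / q` of the points of `X` and `|S| * (d / q) ^ m < 1`, then some `m`-tuple of points contains,
for every `s`, a point that `s` does not reject. -/
theorem exists_tuple_forall_exists_not {S X : Type*} [Fintype S] [Fintype X] (m d q : ℕ)
    (bad : S → X → Prop) [∀ s, DecidablePred (bad s)]
    (hbad : ∀ s, q * (Finset.univ.filter (bad s)).card ≤ d * Fintype.card X)
    (hX : 0 < Fintype.card X) (hlt : Fintype.card S * d ^ m < q ^ m) :
    ∃ f : Fin m → X, ∀ s, ∃ i, ¬ bad s (f i) := by
  classical
  by_contra! h
  have hcover : (Finset.univ : Finset (Fin m → X)) ⊆ Finset.univ.biUnion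
      fun s : S => Fintype.piFinset fun _ : Fin m => Finset.univ.filter (bad s) := by
    intro f _
    obtain ⟨s, hs⟩ := h f
    simpa using ⟨s, hs⟩
  have hcard := (Finset.card_le_card hcover).trans Finset.card_biUnion_le
  simp only [Fintype.card_piFinset, Finset.card_univ, Fintype.card_fun, Finset.prod_const,
    Fintype.card_fin] at hcard
  have hle : q ^ m * Fintype.card X ^ m ≤ Fintype.card S * d ^ m * Fintype.card X ^ m :=
    calc
      _ ≤ q ^ m * ∑ s : S, (Finset.univ.filter (bad s)).card ^ m := by gcongr
      _ = ∑ s : S, (q * (Finset.univ.filter (bad s)).card) ^ m := by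
        simp only [Finset.mul_sum, mul_pow]
      _ ≤ ∑ _s : S, (d * Fintype.card X) ^ m := by
        exact Finset.sum_le_sum fun s _ => Nat.pow_le_pow_left (hbad s) m
      _ = _ := by simp [mul_pow, mul_assoc]
  exact absurd (Nat.le_of_mul_le_mul_right hle (pow_pos hX m)) (not_le.mpr hlt)

/-- At most a fraction `1 / |F|` of all functions `ι → F` agree at two given distinct points. -/
theorem card_mul_card_filter_apply_eq_le {ι F : Type*} [Fintype ι] [DecidableEq ι] [Fintype F]
    [DecidableEq F] {i j : ι} (hij : i ≠ j) :
    Fintype.card F * (Finset.univ.filter fun a : ι → F => a i = a j).card ≤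
      Fintype.card (ι → F) := by
  rw [← Finset.card_univ, ← Finset.card_product, ← Finset.card_univ]
  refine Finset.card_le_card_of_injOn (fun x => Function.update x.2 i x.1) (by simp) ?_
  rintro ⟨c, a⟩ ha ⟨c', a'⟩ ha' h
  simp only [Finset.coe_product, Set.mem_prod, Finset.mem_coe, Finset.mem_filter,
    Finset.mem_univ, true_and] at ha ha'
  have hval (k : ι) := congrFun h k
  have hc : c = c' := by simpa using hval i
  have hne (k : ι) (hk : k ≠ i) : a k = a' k := by simpa [hk] using hval k
  have haa : a = a' := by
    funext k
    by_cases hk : k = i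
    · rw [hk, ha, ha', hne j hij.symm]
    · exact hne k hk
  rw [hc, haa]

/-- At most a fraction `d / |F|` of all functions `ι → F` agree on one of `d` given pairs of
distinct points. -/
theorem card_mul_card_filter_exists_apply_eq_le {ι F : Type*} [Fintype ι] [DecidableEq ι]
    [Fintype F] [DecidableEq F] {d : ℕ} (s : Fin d → ι × ι) :
    Fintype.card F * (Finset.univ.filter fun a : ι → F =>
        ∃ k, (s k).1 ≠ (s k).2 ∧ a (s k).1 = a (s k).2).card ≤
      d * Fintype.card (ι → F) := by
  have hcover : (Finset.univ.filter fun a : ι → F =>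
      ∃ k, (s k).1 ≠ (s k).2 ∧ a (s k).1 = a (s k).2) ⊆ Finset.univ.biUnion fun k =>
        Finset.univ.filter fun a : ι → F => (s k).1 ≠ (s k).2 ∧ a (s k).1 = a (s k).2 := by
    intro a ha
    simpa using ha
  calc
    _ ≤ Fintype.card F * ∑ k, (Finset.univ.filter fun a : ι → F =>
        (s k).1 ≠ (s k).2 ∧ a (s k).1 = a (s k).2).card := by
      gcongr
      exact (Finset.card_le_card hcover).trans Finset.card_biUnion_le
    _ ≤ ∑ _k : Fin d, Fintype.card (ι → F) := by
      rw [Finset.mul_sum]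
      refine Finset.sum_le_sum fun k _ => ?_
      by_cases hk : (s k).1 = (s k).2
      · simp [hk]
      · simpa [hk] using card_mul_card_filter_apply_eq_le (F := F) hk
    _ = _ := by simp

theorem pow_mul_pow_lt_pow_of_le {q d n m : ℕ} (hd : 0 < d) (hn : 0 < n) (hq : d + 2 ≤ q)
    (hm : 4 * ((q : ℝ) - 1) ^ 2 * ((d : ℝ) + 1) * Real.log (q * (n + 1)) /
      ((q : ℝ) - (d : ℝ) - 1) ^ 2 ≤ m) :
    (n * n) ^ d * d ^ m < q ^ m := by
  have hd' : (1 : ℝ) ≤ d := by exact_mod_cast hd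
  have hn' : (1 : ℝ) ≤ n := by exact_mod_cast hn
  have hq' : (d : ℝ) + 2 ≤ q := by exact_mod_cast hq
  have hq0 : (0 : ℝ) < q := by linarith
  have ht : (0 : ℝ) < ((q : ℝ) - d - 1) ^ 2 := by
    have : (0 : ℝ) < (q : ℝ) - d - 1 := by linarith
    positivity
  have hL : Real.log n < Real.log (q * (n + 1)) := Real.log_lt_log (by linarith) (by nlinarith)
  have hn0 : 0 ≤ Real.log n := Real.log_nonneg hn'
  set L := Real.log (q * (n + 1))
  have hlog : ((q : ℝ) - d) / q ≤ Real.log q - Real.log d := by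
    rw [← Real.log_div hq0.ne' (by linarith)]
    refine le_trans (le_of_eq ?_) (Real.one_sub_inv_le_log_of_pos (by positivity))
    field_simp
  have hratio : (q : ℝ) * ((q : ℝ) - d - 1) ^ 2 ≤ ((q : ℝ) - 1) ^ 2 * ((q : ℝ) - d) := by
    have h1 : (q : ℝ) * ((q : ℝ) - d - 1) ≤ ((q : ℝ) - 1) * ((q : ℝ) - d) := by nlinarith
    have h2 : (q : ℝ) - d - 1 ≤ (q : ℝ) - 1 := by linarith
    have h3 := mul_le_mul h1 h2 (by linarith) (mul_nonneg (by linarith) (by linarith))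
    nlinarith
  have hmain : 4 * ((d : ℝ) + 1) * L ≤ m * (((q : ℝ) - d) / q) := by
    rw [div_le_iff₀ ht] at hm
    rw [← mul_div_assoc, le_div_iff₀ hq0]
    refine le_of_mul_le_mul_right ?_ ht
    have hc : 0 ≤ 4 * ((d : ℝ) + 1) * L := mul_nonneg (by linarith) (by linarith)
    have h1 := mul_le_mul_of_nonneg_left hratio hc
    have h2 := mul_le_mul_of_nonneg_right hm (by linarith : 0 ≤ (q : ℝ) - d)
    nlinarith
  have hmlog := mul_le_mul_of_nonneg_left hlog (Nat.cast_nonneg (α := ℝ) m)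
  have hreal : ((n : ℝ) * n) ^ d * (d : ℝ) ^ m < (q : ℝ) ^ m := by
    rw [← Real.log_lt_log_iff (by positivity) (by positivity),
      Real.log_mul (by positivity) (by positivity), Real.log_pow, Real.log_pow, Real.log_pow,
      Real.log_mul (by positivity) (by positivity)]
    nlinarith
  exact_mod_cast hreal

/-- Let `q` be a prime power and `d, n` positive integers with `n > q`, `n > d` and
`d + 2 ≤ q ≤ 4(d+1)`.  Then there exists a hitting set `A` for `H_d` over `F_q` of size
at most `⌈4(q−1)²·(d+1)·ln(q(n+1)) / (q−d−1)²⌉`.  A hitting set for `H_d` is a finite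
set `A ⊆ F_q^n` such that for every `I ⊆ [n]×[n]` with `|I| ≤ d` and `i₁ ≠ i₂` for
every `(i₁,i₂) ∈ I`, there is `a ∈ A` with `a_{i₁} ≠ a_{i₂}` for all `(i₁,i₂) ∈ I`. -/
theorem exists_hitting_set_small_q (q d n : ℕ) (hq : IsPrimePow q)
    (hd : 0 < d) (hn : 0 < n) (hnq : n > q) (hnd : n > d)
    (hq1 : d + 2 ≤ q) (hq2 : q ≤ 4 * (d + 1))
    (F : Type) [Field F] [Fintype F] (hF : Fintype.card F = q) :
    ∃ A : Finset (Fin n → F),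
      A.card ≤
        ⌈4 * ((q : ℝ) - 1) ^ 2 * ((d : ℝ) + 1) * Real.log (q * (n + 1)) /
          ((q : ℝ) - (d : ℝ) - 1) ^ 2⌉₊ ∧
      ∀ I : Finset (Fin n × Fin n), I.card ≤ d → (∀ p ∈ I, p.1 ≠ p.2) →
        ∃ a ∈ A, ∀ p ∈ I, a p.1 ≠ a p.2 := by
  classical
  set M : ℝ := 4 * ((q : ℝ) - 1) ^ 2 * ((d : ℝ) + 1) * Real.log (q * (n + 1)) /
    ((q : ℝ) - (d : ℝ) - 1) ^ 2
  obtain ⟨f, hf⟩ := exists_tuple_forall_exists_not ⌈M⌉₊ d q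
    (fun (s : Fin d → Fin n × Fin n) (a : Fin n → F) =>
      ∃ k, (s k).1 ≠ (s k).2 ∧ a (s k).1 = a (s k).2)
    (fun s => hF ▸ card_mul_card_filter_exists_apply_eq_le s) Fintype.card_pos
    (by simpa using pow_mul_pow_lt_pow_of_le hd hn hq1 (Nat.le_ceil M))
  refine ⟨Finset.univ.image f, by simpa using Finset.card_image_le (s := Finset.univ) (f := f),
    fun I hI hne => ?_⟩
  obtain ⟨e⟩ : Nonempty (I ↪ Fin d) := Function.Embedding.nonempty_of_card_le (by simpa using hI)
  obtain ⟨i, hi⟩ := hf (Function.extend e Subtype.val fun _ => (⟨0, hn⟩, ⟨0, hn⟩))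
  refine ⟨f i, Finset.mem_image_of_mem f (Finset.mem_univ i), fun p hp heq => hi ⟨e ⟨p, hp⟩, ?_⟩⟩
  rw [e.injective.extend_apply]
  exact ⟨hne p hp, heq⟩
end

section
/- Let q be a prime power, d ≥ 2 and n integers with n > q, and set D = d(d−1)/2 + 1. If q > 4D, then there exists an (n,q,d)-perfect hash family of size at most ⌈D·log(q(n+1)) / log(q/(eD))⌉. -/
/-- If each of the sets `bad i`, `i ∈ s`, has density at most `B / q` in `α` and
`#s * (B / q) ^ N < 1`, then some `N`-tuple has, for each `i ∈ s`, an entry outside `bad i`. -/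
theorem exists_tuple_forall_exists_notMem {α ι : Type*} [Fintype α] [Nonempty α]
    (s : Finset ι) (bad : ι → Finset α) (q B N : ℕ)
    (hbad : ∀ i ∈ s, (bad i).card * q ≤ B * Fintype.card α)
    (hN : s.card * B ^ N < q ^ N) :
    ∃ f : Fin N → α, ∀ i ∈ s, ∃ k, f k ∉ bad i := by
  classical
  by_contra! hcon
  have hcover : (Finset.univ : Finset (Fin N → α)) ⊆
      s.biUnion fun i => Fintype.piFinset fun _ => bad i := by
    intro f _
    obtain ⟨i, hi, hf⟩ := hcon f
    exact Finset.mem_biUnion.2 ⟨i, hi, Fintype.mem_piFinset.2 hf⟩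
  have hcard : Fintype.card α ^ N ≤ ∑ i ∈ s, (bad i).card ^ N := by
    have h := (Finset.card_le_card hcover).trans Finset.card_biUnion_le
    simpa [Fintype.card_piFinset_const] using h
  have hle : Fintype.card α ^ N * q ^ N ≤ Fintype.card α ^ N * (s.card * B ^ N) := by
    calc Fintype.card α ^ N * q ^ N
        ≤ (∑ i ∈ s, (bad i).card ^ N) * q ^ N := by gcongr
      _ = ∑ i ∈ s, ((bad i).card * q) ^ N := by simp only [Finset.sum_mul, mul_pow]
      _ ≤ ∑ _i ∈ s, (B * Fintype.card α) ^ N :=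
          Finset.sum_le_sum fun i hi => Nat.pow_le_pow_left (hbad i hi) N
      _ = Fintype.card α ^ N * (s.card * B ^ N) := by
          rw [Finset.sum_const, smul_eq_mul, mul_pow]; ring
  exact absurd (Nat.le_of_mul_le_mul_left hle (pow_pos Fintype.card_pos N)) hN.not_ge

/-- The functions identifying two given points have density at most `1 / #β`. -/
theorem card_filter_apply_eq_mul_card_le {α β : Type*} [Fintype α] [DecidableEq α] [Fintype β]
    [DecidableEq β] {a b : α} (hab : a ≠ b) :
    (Finset.univ.filter fun h : α → β => h a = h b).card * Fintype.card β ≤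
      Fintype.card (α → β) := by
  rw [← Finset.card_univ (α := β), ← Finset.card_product, ← Finset.card_univ (α := α → β)]
  refine Finset.card_le_card_of_injOn (fun p => Function.update p.1 a p.2) (by simp) ?_
  rintro ⟨h, c⟩ hp ⟨h', c'⟩ hp' heq
  have hh : h a = h b := by simpa using hp
  have hh' : h' a = h' b := by simpa using hp'
  have hval (x : α) : Function.update h a c x = Function.update h' a c' x := congrFun heq x
  have hoff (x : α) (hx : x ≠ a) : h x = h' x := by simpa [hx] using hval x
  refine Prod.ext (funext fun x => ?_) (by simpa using hval a)
  by_cases hx : x = a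
  · subst hx
    exact hh.trans ((hoff b hab.symm).trans hh'.symm)
  · exact hoff x hx

open Classical in
/-- The functions not injective on `S` have density at most `#S * (#S - 1) / #β`. -/
theorem card_filter_not_injOn_mul_card_le {α β : Type*} [Fintype α] [Fintype β]
    (S : Finset α) :
    (Finset.univ.filter fun h : α → β => ¬ Set.InjOn h ↑S).card * Fintype.card β ≤
      S.card * (S.card - 1) * Fintype.card (α → β) := by
  have hsub : (Finset.univ.filter fun h : α → β => ¬ Set.InjOn h ↑S) ⊆
      S.offDiag.biUnion fun p => Finset.univ.filter fun h : α → β => h p.1 = h p.2 := by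
    intro h hh
    have hinj := (Finset.mem_filter.1 hh).2
    simp only [Set.InjOn, not_forall] at hinj
    obtain ⟨a, ha, b, hb, heq, hne⟩ := hinj
    exact Finset.mem_biUnion.2 ⟨(a, b), Finset.mem_offDiag.2 ⟨ha, hb, hne⟩, by simpa using heq⟩
  calc (Finset.univ.filter fun h : α → β => ¬ Set.InjOn h ↑S).card * Fintype.card β
      ≤ (∑ p ∈ S.offDiag, (Finset.univ.filter fun h : α → β => h p.1 = h p.2).card) *
          Fintype.card β :=
        Nat.mul_le_mul_right _ ((Finset.card_le_card hsub).trans Finset.card_biUnion_le)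
    _ ≤ ∑ _p ∈ S.offDiag, Fintype.card (α → β) := by
        rw [Finset.sum_mul]
        exact Finset.sum_le_sum fun p hp =>
          card_filter_apply_eq_mul_card_le (Finset.mem_offDiag.1 hp).2.2
    _ = S.card * (S.card - 1) * Fintype.card (α → β) := by
        rw [Finset.sum_const, smul_eq_mul, Finset.offDiag_card, Nat.mul_sub_one]

/-- The union bound for perfect hash families. -/
theorem exists_perfectHashFamily_of_pow_lt (n q d N : ℕ) (hq : 0 < q)
    (hN : n ^ d * (d * (d - 1)) ^ N < q ^ N) :
    ∃ H : Finset (Fin n → Fin q), H.card ≤ N ∧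
      ∀ S : Finset (Fin n), S.card = d → ∃ h ∈ H, Set.InjOn h ↑S := by
  classical
  have : NeZero q := ⟨hq.ne'⟩
  obtain ⟨f, hf⟩ := exists_tuple_forall_exists_notMem
    (Finset.powersetCard d (Finset.univ : Finset (Fin n)))
    (fun S => Finset.univ.filter fun h : Fin n → Fin q => ¬ Set.InjOn h ↑S) q (d * (d - 1)) N
    (fun S hS => by
      have h := card_filter_not_injOn_mul_card_le (β := Fin q) S
      rw [(Finset.mem_powersetCard.1 hS).2, Fintype.card_fin] at h
      convert h)
    (by
      rw [Finset.card_powersetCard, Finset.card_univ, Fintype.card_fin]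
      exact (Nat.mul_le_mul_right _ (Nat.choose_le_pow n d)).trans_lt hN)
  refine ⟨Finset.univ.image f, Finset.card_image_le.trans (by simp), fun S hS => ?_⟩
  obtain ⟨k, hk⟩ := hf S (Finset.mem_powersetCard.2 ⟨Finset.subset_univ S, hS⟩)
  exact ⟨f k, Finset.mem_image_of_mem f (Finset.mem_univ k), by simpa using hk⟩


/-- Let `q` be a prime power, `d ≥ 2` and `n` integers with `n > q`, and set
`D = d(d−1)/2 + 1`.  If `q > 4D` then there exists an `(n,q,d)`-perfect hash family of
size at most `⌈D·log(q(n+1)) / log(q/(eD))⌉`: a family `H` of functions `[n] → [q]`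
such that every subset `S ⊆ [n]` with `|S| = d` admits some `h ∈ H` injective on `S`. -/
theorem exists_PHF_large_q (q d n : ℕ) (hq : IsPrimePow q) (hd : 2 ≤ d) (hn : n > q)
    (D : ℕ) (hD : D = d * (d - 1) / 2 + 1) (hqD : q > 4 * D) :
    ∃ H : Finset (Fin n → Fin q),
      H.card ≤
        ⌈(D : ℝ) * Real.log (q * (n + 1)) /
          Real.log (q / (Real.exp 1 * (D : ℝ)))⌉₊ ∧
      ∀ S : Finset (Fin n), S.card = d → ∃ h ∈ H, Set.InjOn h ↑S := by
  have hDd : d ≤ D := by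
    have h : d * (d - 1) ≥ 2 * (d - 1) := Nat.mul_le_mul_right _ hd
    omega
  have hB : d * (d - 1) ≤ 2 * D := by omega
  have hD0 : 0 < D := by omega
  have hq0 : 0 < q := by omega
  have hDR : (0 : ℝ) < D := by exact_mod_cast hD0
  have hqR : (0 : ℝ) < q := by exact_mod_cast hq0
  set E : ℝ := Real.exp 1 * D with hE
  have hE0 : 0 < E := by positivity
  have hEq : 1 < (q : ℝ) / E := by
    have h4 : (4 : ℝ) * D < q := by exact_mod_cast hqD
    rw [one_lt_div hE0]
    nlinarith [Real.exp_one_lt_d9]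
  have hBE : ((d * (d - 1) : ℕ) : ℝ) ≤ E := by
    have h2 : ((d * (d - 1) : ℕ) : ℝ) ≤ 2 * D := by exact_mod_cast hB
    nlinarith [Real.exp_one_gt_d9]
  set N := ⌈(D : ℝ) * Real.log (q * (n + 1)) / Real.log (q / E)⌉₊ with hNdef
  refine exists_perfectHashFamily_of_pow_lt n q d N hq0 ?_
  have hlog : (D : ℝ) * Real.log (q * (n + 1)) ≤ N * Real.log (q / E) :=
    (div_le_iff₀ (Real.log_pos hEq)).1 (Nat.le_ceil _)
  have hpow : ((q : ℝ) * (n + 1)) ^ D ≤ (q / E) ^ N := by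
    rw [← Real.log_pow, ← Real.log_pow] at hlog
    exact (Real.log_le_log_iff (by positivity) (by positivity)).1 hlog
  have hlt : (n : ℝ) ^ d < ((q : ℝ) * (n + 1)) ^ D := by
    have hq1 : (1 : ℝ) ≤ q := by exact_mod_cast hq0
    have hnn : (n : ℝ) < q * (n + 1) := by nlinarith [(Nat.cast_nonneg n : (0 : ℝ) ≤ n)]
    calc (n : ℝ) ^ d < ((q : ℝ) * (n + 1)) ^ d :=
          pow_lt_pow_left₀ hnn (Nat.cast_nonneg n) (by omega)
      _ ≤ ((q : ℝ) * (n + 1)) ^ D :=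
          pow_le_pow_right₀ (by nlinarith [(Nat.cast_nonneg n : (0 : ℝ) ≤ n)]) hDd
  have hfin : (n : ℝ) ^ d * ((d * (d - 1) : ℕ) : ℝ) ^ N < (q : ℝ) ^ N :=
    calc (n : ℝ) ^ d * ((d * (d - 1) : ℕ) : ℝ) ^ N ≤ (n : ℝ) ^ d * E ^ N := by gcongr
      _ < (q / E) ^ N * E ^ N := by
          have := hlt.trans_le hpow
          gcongr
      _ = (q : ℝ) ^ N := by rw [← mul_pow, div_mul_cancel₀ _ hE0.ne']
  exact_mod_cast hfin
end

section
/- Let q be a prime power, 0 < ε < 1, d ≥ 2 and n integers with n > q, and set D = d(d−1)/2 + 1. If q > 4D/ε, then there exists a (1−ε)-dense (n,q,d)-perfect hash family of size at most ⌈D·log(q(n+1)) / (ε·log(εq/(eD)))⌉. -/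
open Finset in
theorem card_eq_at_mul_le {α β : Type*} [Fintype α] [Fintype β] [DecidableEq α] [DecidableEq β]
    {i j : α} (hij : i ≠ j) :
    Fintype.card β * #{h : α → β | h i = h j} ≤ Fintype.card (α → β) := by
  rw [mul_comm, ← card_univ (α := β), ← card_product, ← card_univ]
  refine card_le_card_of_injOn (fun x => Function.update x.1 j x.2) (by simp) ?_
  rintro ⟨h, c⟩ hh ⟨g, b⟩ hg heq
  simp only [coe_product, coe_filter, mem_univ, true_and, coe_univ, Set.mem_prod, Set.mem_ofPred_eq,
    Set.mem_univ, and_true] at hh hg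
  have hval : ∀ k, k ≠ j → h k = g k := fun k hk => by
    simpa [Function.update_of_ne hk] using congrFun heq k
  have hc : c = b := by simpa using congrFun heq j
  refine Prod.ext (funext fun k => ?_) hc
  rcases eq_or_ne k j with rfl | hk
  · exact hh.symm.trans ((hval i hij).trans hg)
  · exact hval k hk

open Finset in
open scoped Classical in
theorem card_not_injOn_mul_le {α β : Type*} [Fintype α] [Fintype β] [DecidableEq α]
    [DecidableEq β] (S : Finset α) :
    Fintype.card β * #{h : α → β | ¬ Set.InjOn h S} ≤
      (#S).choose 2 * Fintype.card (α → β) := by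
  have hsub : (univ.filter fun h : α → β => ¬ Set.InjOn h S) ⊆
      (S.powersetCard 2).biUnion fun P => univ.filter fun h : α → β => ¬ Set.InjOn h P := by
    intro h hh
    simp only [mem_filter, mem_univ, true_and, Set.InjOn, not_forall] at hh
    obtain ⟨x, hx, y, hy, hxy, hne⟩ := hh
    simp only [mem_biUnion, mem_powersetCard, mem_filter, mem_univ, true_and]
    refine ⟨{x, y}, ⟨?_, card_pair hne⟩, fun hinj => hne (hinj (by simp) (by simp) hxy)⟩
    intro z hz
    rcases mem_insert.1 hz with rfl | hz
    · exact hx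
    · exact mem_singleton.1 hz ▸ hy
  calc _ ≤ Fintype.card β * ∑ P ∈ S.powersetCard 2, #{h : α → β | ¬ Set.InjOn h P} :=
        Nat.mul_le_mul_left _ ((card_le_card hsub).trans card_biUnion_le)
    _ = ∑ P ∈ S.powersetCard 2, Fintype.card β * #{h : α → β | ¬ Set.InjOn h P} := mul_sum ..
    _ ≤ ∑ P ∈ S.powersetCard 2, Fintype.card (α → β) := by
        refine sum_le_sum fun P hP => ?_
        obtain ⟨x, y, hne, rfl⟩ := card_eq_two.1 (mem_powersetCard.1 hP).2
        refine le_trans (Nat.mul_le_mul_left _ (card_le_card ?_)) (card_eq_at_mul_le hne)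
        intro h hh
        simp only [mem_filter, mem_univ, true_and] at hh ⊢
        by_contra hxy
        refine hh ?_
        rw [coe_pair, Set.injOn_pair]
        exact fun heq => absurd heq hxy
    _ = _ := by simp [card_powersetCard]

open Finset in
/-- Chernoff bound and union bound: a sequence of `N` elements of `α` can be chosen so that each
of the properties `bad s` holds for at most `ε * N` of its terms. -/
theorem exists_seq_card_bad_le {α ι : Type*} [Fintype α] [Nonempty α] (T : Finset ι)
    (bad : ι → α → Prop) [∀ s, DecidablePred (bad s)] (N : ℕ) {p t ε : ℝ} (ht : 1 ≤ t)
    (hp : ∀ s ∈ T, (#{a | bad s a} : ℝ) ≤ p * Fintype.card α)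
    (hlt : #T * Real.exp (N * (p * (t - 1))) < t ^ (ε * N)) :
    ∃ H : Fin N → α, ∀ s ∈ T, (#{i | bad s (H i)} : ℝ) ≤ ε * N := by
  by_contra! hcon
  have ht0 : 0 < t := by linarith
  have hmoment : ∀ s ∈ T, ∑ H : Fin N → α, t ^ #{i | bad s (H i)} ≤
      (Fintype.card α : ℝ) ^ N * Real.exp (N * (p * (t - 1))) := by
    intro s hs
    have hsum : ∑ a : α, (if bad s a then t else 1) =
        Fintype.card α + (t - 1) * #{a | bad s a} := by
      have : ∀ a, (if bad s a then t else 1) = 1 + (t - 1) * (if bad s a then 1 else 0) := by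
        intro a; split_ifs <;> ring
      simp only [this, sum_add_distrib, ← mul_sum, sum_boole]
      simp
    have hprod : ∀ H : Fin N → α, t ^ #{i | bad s (H i)} = ∏ i, if bad s (H i) then t else 1 := by
      intro H
      rw [prod_ite]
      simp
    calc ∑ H : Fin N → α, t ^ #{i | bad s (H i)}
        = (∑ a : α, if bad s a then t else 1) ^ N := by
          rw [Fintype.sum_pow]
          exact sum_congr rfl fun H _ => hprod H
      _ ≤ (Fintype.card α * Real.exp (p * (t - 1))) ^ N := by
          refine pow_le_pow_left₀ (sum_nonneg fun a _ => by split_ifs <;> linarith) ?_ N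
          rw [hsum]
          have h1 := mul_le_mul_of_nonneg_left (hp s hs) (sub_nonneg.2 ht)
          have h2 := mul_le_mul_of_nonneg_left (Real.add_one_le_exp (p * (t - 1)))
            (Nat.cast_nonneg (α := ℝ) (Fintype.card α))
          nlinarith
      _ = _ := by rw [mul_pow, ← Real.exp_nat_mul]
  have hlower : ∀ H : Fin N → α, t ^ (ε * N) ≤ ∑ s ∈ T, t ^ #{i | bad s (H i)} := by
    intro H
    obtain ⟨s, hs, hbad⟩ := hcon H
    calc t ^ (ε * N) ≤ t ^ (#{i | bad s (H i)} : ℝ) := Real.rpow_le_rpow_of_exponent_le ht hbad.le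
      _ = t ^ #{i | bad s (H i)} := Real.rpow_natCast ..
      _ ≤ _ := single_le_sum (f := fun s => t ^ #{i | bad s (H i)})
        (fun _ _ => by positivity) hs
  have hcard : (0 : ℝ) < (Fintype.card α : ℝ) ^ N := by
    have : 0 < Fintype.card α := Fintype.card_pos
    positivity
  have htotal : (Fintype.card α : ℝ) ^ N * t ^ (ε * N) ≤
      #T * ((Fintype.card α : ℝ) ^ N * Real.exp (N * (p * (t - 1)))) := by
    calc (Fintype.card α : ℝ) ^ N * t ^ (ε * N) = ∑ _H : Fin N → α, t ^ (ε * N) := by simp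
      _ ≤ ∑ H : Fin N → α, ∑ s ∈ T, t ^ #{i | bad s (H i)} := sum_le_sum fun H _ => hlower H
      _ = ∑ s ∈ T, ∑ H : Fin N → α, t ^ #{i | bad s (H i)} := sum_comm
      _ ≤ ∑ _s ∈ T, (Fintype.card α : ℝ) ^ N * Real.exp (N * (p * (t - 1))) :=
        sum_le_sum hmoment
      _ = _ := by simp
  nlinarith [mul_lt_mul_of_pos_left hlt hcard]


/-- Let `q` be a prime power, `0 < ε < 1`, `d ≥ 2` and `n` integers with `n > q`, and
set `D = d(d−1)/2 + 1`.  If `q > 4D/ε` then there exists a `(1−ε)`-dense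
`(n,q,d)`-perfect hash family of size at most `⌈D·log(q(n+1)) / (ε·log(εq/(eD)))⌉`:
a finite family `H` (a finite sequence, counted with multiplicity) of functions
`[n] → [q]` such that for every subset `S ⊆ [n]` with `|S| = d`, at least `(1−ε)|H|`
of the functions `h ∈ H` are injective on `S`. -/
theorem exists_dense_PHF_large_q (q d n : ℕ) (hq : IsPrimePow q) (ε : ℝ)
    (hε0 : 0 < ε) (hε1 : ε < 1) (hd : 2 ≤ d) (hn : n > q)
    (D : ℕ) (hD : D = d * (d - 1) / 2 + 1) (hqD : (q : ℝ) > 4 * (D : ℝ) / ε) :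
    ∃ (N : ℕ) (H : Fin N → (Fin n → Fin q)),
      0 < N ∧
      N ≤
        ⌈(D : ℝ) * Real.log (q * (n + 1)) /
          (ε * Real.log (ε * q / (Real.exp 1 * (D : ℝ))))⌉₊ ∧
      ∀ S : Finset (Fin n), S.card = d →
        (1 - ε) * N ≤ (Nat.card {i : Fin N // Set.InjOn (H i) ↑S} : ℝ) := by
  classical
  have hD0 : 0 < (D : ℝ) := by exact_mod_cast (by omega : 0 < D)
  have hqD' : 4 * (D : ℝ) < ε * q := by
    have := (div_lt_iff₀ hε0).1 hqD
    linarith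
  have hq1 : (1 : ℝ) ≤ q := by exact_mod_cast hq.one_lt.le
  have hqpos : (0 : ℝ) < q := by linarith
  have hnpos : (0 : ℝ) < n := hqpos.trans (by exact_mod_cast hn)
  have hdD : d ≤ D := by
    obtain ⟨k, rfl⟩ := Nat.exists_eq_add_of_le hd
    have : (2 + k - 1) * 2 ≤ (2 + k) * (2 + k - 1) := by
      rw [mul_comm]
      exact Nat.mul_le_mul_right _ (by omega)
    omega
  have htpos : 0 < ε * q / D := by positivity
  have ht4 : 4 < ε * q / D := by rwa [lt_div_iff₀ hD0]
  have hlogt : Real.log (ε * q / (Real.exp 1 * D)) = Real.log (ε * q / D) - 1 := by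
    rw [mul_comm (Real.exp 1), ← div_div, Real.log_div htpos.ne' (Real.exp_ne_zero 1),
      Real.log_exp]
  have hlog_pos : 0 < Real.log (ε * q / D) - 1 := by
    rw [sub_pos, Real.lt_log_iff_exp_lt htpos]
    linarith [Real.exp_one_lt_d9]
  have hlog_lt : Real.log n < Real.log (q * (n + 1)) :=
    Real.log_lt_log hnpos (by nlinarith)
  have hn1 : (1 : ℝ) ≤ n := by exact_mod_cast (by omega : 1 ≤ n)
  have hlogn : 0 ≤ Real.log n := Real.log_nonneg hn1
  have hden : 0 < ε * (Real.log (ε * q / D) - 1) := mul_pos hε0 hlog_pos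
  rw [hlogt]
  set x := (D : ℝ) * Real.log (q * (n + 1)) / (ε * (Real.log (ε * q / D) - 1)) with hx
  have hxpos : 0 < x := div_pos (mul_pos hD0 (hlogn.trans_lt hlog_lt)) hden
  have hbound : d * Real.log n < ε * ⌈x⌉₊ * (Real.log (ε * q / D) - 1) := by
    have h1 : (D : ℝ) * Real.log (q * (n + 1)) ≤ ⌈x⌉₊ * (ε * (Real.log (ε * q / D) - 1)) :=
      (div_le_iff₀ hden).1 (Nat.le_ceil x)
    have h2 : (d : ℝ) * Real.log n ≤ D * Real.log n :=
      mul_le_mul_of_nonneg_right (by exact_mod_cast hdD) hlogn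
    have h3 := mul_lt_mul_of_pos_left hlog_lt hD0
    linarith
  have : NeZero q := ⟨by rintro rfl; simp at hqpos⟩
  have hcollision : ∀ S ∈ (Finset.univ : Finset (Fin n)).powersetCard d,
      ((Finset.univ.filter fun h : Fin n → Fin q => ¬ Set.InjOn h S).card : ℝ) ≤
        D / q * Fintype.card (Fin n → Fin q) := by
    intro S hS
    have h := card_not_injOn_mul_le (β := Fin q) S
    rw [(Finset.mem_powersetCard.1 hS).2, Nat.choose_two_right, Fintype.card_fin] at h
    have h' := h.trans (Nat.mul_le_mul_right _ (by omega : d * (d - 1) / 2 ≤ D))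
    rw [div_mul_eq_mul_div, le_div_iff₀ hqpos, mul_comm]
    exact_mod_cast h'
  have hunion : ((Finset.univ.powersetCard d : Finset (Finset (Fin n))).card : ℝ) *
      Real.exp (⌈x⌉₊ * (D / q * (ε * q / D - 1))) < (ε * q / D) ^ (ε * ⌈x⌉₊) := by
    have hcard : ((Finset.univ.powersetCard d : Finset (Finset (Fin n))).card : ℝ) ≤
        Real.exp (d * Real.log n) := by
      rw [Real.exp_nat_mul, Real.exp_log hnpos, Finset.card_powersetCard, Finset.card_univ,
        Fintype.card_fin]
      exact_mod_cast Nat.choose_le_pow n d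
    have hmean : D / q * (ε * q / D - 1) ≤ ε := by
      have : D / q * (ε * q / D - 1) = ε - D / q := by field_simp
      rw [this]
      linarith [div_pos hD0 hqpos]
    refine (mul_le_mul_of_nonneg_right hcard (Real.exp_pos _).le).trans_lt ?_
    rw [← Real.exp_add, Real.rpow_def_of_pos htpos, Real.exp_lt_exp]
    have := mul_le_mul_of_nonneg_left hmean (Nat.cast_nonneg (α := ℝ) ⌈x⌉₊)
    linarith
  obtain ⟨H, hH⟩ := exists_seq_card_bad_le (Finset.univ.powersetCard d)
    (fun (S : Finset (Fin n)) (h : Fin n → Fin q) => ¬ Set.InjOn h S) ⌈x⌉₊ (by linarith) hcollision hunion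
  refine ⟨⌈x⌉₊, H, Nat.ceil_pos.2 hxpos, le_rfl, fun S hS => ?_⟩
  have hbad := hH S (Finset.mem_powersetCard.2 ⟨Finset.subset_univ _, hS⟩)
  have hsplit := Finset.card_filter_add_card_filter_not (s := Finset.univ)
    (fun i : Fin ⌈x⌉₊ => Set.InjOn (H i) S)
  rw [Finset.card_univ, Fintype.card_fin] at hsplit
  have hsplit' := congrArg (Nat.cast (R := ℝ)) hsplit
  push_cast at hsplit'
  rw [Nat.card_eq_fintype_card, Fintype.card_subtype]
  linarith
end

section
/- Let q be a prime power, 0 < ε < 1, d ≥ 2 and n integers with n > q, and set D = d(d−1)/2 + 1. If D/ε + 1 ≤ q ≤ 4D/ε, then there exists a (1−ε)-dense (n,q,d)-perfect hash family of size at most ⌈4(q−1)²·D·ln(q(n+1)) / ((q − D/ε)²·ε)⌉. -/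
open Finset in
/-- The number of words agreeing with `x` in more than `s` coordinates is bounded by the
exponential moment of the agreement count. -/
lemma card_agree_gt_le {ι α : Type*} [Fintype ι] [Fintype α] [DecidableEq ι] [DecidableEq α]
    [Nonempty α] (x : ι → α) {t : ℝ} (ht : 0 ≤ t) (s : ℝ) :
    ((univ.filter fun y : ι → α => s < ((univ.filter fun i => x i = y i).card : ℝ)).card : ℝ) ≤
      (Fintype.card α : ℝ) ^ Fintype.card ι *
        Real.exp (Fintype.card ι * ((Real.exp t - 1) / Fintype.card α) - t * s) := by
  have hq : (0 : ℝ) < Fintype.card α := by exact_mod_cast Fintype.card_pos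
  have hsum : ∑ y : ι → α, Real.exp (t * ((univ.filter fun i => x i = y i).card : ℝ)) =
      (Real.exp t + (Fintype.card α - 1)) ^ Fintype.card ι := by
    have hcoord (i : ι) : ∑ v : α, (if x i = v then Real.exp t else 1) =
        Real.exp t + (Fintype.card α - 1) := by
      have (v : α) : (if x i = v then Real.exp t else 1) =
          (if x i = v then Real.exp t - 1 else 0) + 1 := by split_ifs <;> ring
      simp only [this, sum_add_distrib, sum_ite_eq, mem_univ, if_true, sum_const, card_univ,
        nsmul_eq_mul]
      ring
    calc _ = ∑ y : ι → α, ∏ i, (if x i = y i then Real.exp t else 1) := by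
          refine sum_congr rfl fun y _ => ?_
          rw [prod_ite, prod_const_one, mul_one, prod_const, ← Real.exp_nat_mul, mul_comm]
      _ = ∏ i, ∑ v : α, (if x i = v then Real.exp t else 1) := by
          rw [prod_univ_sum, Fintype.piFinset_univ]
      _ = _ := by simp [hcoord]
  have hmarkov : ((univ.filter fun y : ι → α =>
      s < ((univ.filter fun i => x i = y i).card : ℝ)).card : ℝ) * Real.exp (t * s) ≤
      (Real.exp t + (Fintype.card α - 1)) ^ Fintype.card ι := by
    rw [← hsum, ← nsmul_eq_mul, ← sum_const]
    refine (sum_le_sum fun y hy => ?_).trans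
      (sum_le_sum_of_subset_of_nonneg (filter_subset _ _) fun _ _ _ => (Real.exp_pos _).le)
    rw [mem_filter] at hy
    exact Real.exp_le_exp.2 (mul_le_mul_of_nonneg_left hy.2.le ht)
  have hbase : Real.exp t + (Fintype.card α - 1) ≤
      Fintype.card α * Real.exp ((Real.exp t - 1) / Fintype.card α) := by
    have h := Real.add_one_le_exp ((Real.exp t - 1) / (Fintype.card α : ℝ))
    calc Real.exp t + ((Fintype.card α : ℝ) - 1)
        = Fintype.card α * ((Real.exp t - 1) / Fintype.card α + 1) := by field_simp; ring
      _ ≤ _ := mul_le_mul_of_nonneg_left h hq.le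
  have hpos : 0 ≤ Real.exp t + ((Fintype.card α : ℝ) - 1) := by
    linarith [Real.one_le_exp ht]
  rw [Real.exp_sub, ← mul_div_assoc, le_div_iff₀ (Real.exp_pos _), Real.exp_nat_mul, ← mul_pow]
  exact hmarkov.trans (pow_le_pow_left₀ hpos hbase _)

open Finset in
/-- Greedy packing: if every point has few conflicts, then `n` pairwise non-conflicting points
can be chosen. -/
lemma exists_pairwise_of_card_conflict_lt {V : Type*} [Fintype V] (R : V → V → Prop)
    [DecidableRel R] (hR : ∀ x y, R x y → R y x) {b : ℝ} (hb0 : 0 ≤ b)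
    (hb : ∀ x, ((univ.filter fun y => R x y).card : ℝ) ≤ b) (n : ℕ)
    (hn : n * b < Fintype.card V) :
    ∃ c : Fin n → V, ∀ i j, i ≠ j → ¬ R (c i) (c j) := by
  classical
  induction n with
  | zero => exact ⟨Fin.elim0, fun i => i.elim0⟩
  | succ n ih =>
    have hn' : (n : ℝ) * b < Fintype.card V := by
      push_cast at hn
      linarith
    obtain ⟨c, hc⟩ := ih hn'
    obtain ⟨y, hy⟩ : ∃ y, ∀ i, ¬ R (c i) y := by
      by_contra! hcon
      have hcover : (univ : Finset V) ⊆ univ.biUnion fun i => univ.filter fun y => R (c i) y := by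
        intro y _
        simpa using hcon y
      have h1 : (Fintype.card V : ℝ) ≤ ∑ i : Fin n, ((univ.filter fun y => R (c i) y).card : ℝ) := by
        exact_mod_cast (card_le_card hcover).trans card_biUnion_le
      have h2 := h1.trans (sum_le_sum fun i _ => hb (c i))
      simp at h2
      linarith
    refine ⟨Fin.cons y c, fun i j hij => ?_⟩
    cases i using Fin.cases <;> cases j using Fin.cases
    · exact absurd rfl hij
    · simpa using fun h => hy _ (hR _ _ h)
    · simpa using hy _
    · simpa using hc _ _ fun h => hij (congrArg _ h)

lemma add_sq_half_le_neg_log_one_sub {v : ℝ} (h0 : 0 ≤ v) (h1 : v < 1) :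
    v + v ^ 2 / 2 ≤ -Real.log (1 - v) := by
  have h := Real.hasSum_pow_div_log_of_abs_lt_one (abs_lt.2 ⟨by linarith, h1⟩)
  have := sum_le_hasSum (Finset.range 2) (fun i _ => by positivity) h
  simpa [Finset.sum_range_succ, one_add_one_eq_two] using this

open Finset in
/-- If any two points collide under at most `s` functions, then at most `s * (d choose 2)`
functions fail to be injective on a given `d`-set. -/
lemma card_not_injOn_le {ι β γ : Type*} [Fintype ι] [DecidableEq β] [DecidableEq γ] {s : ℝ}
    (H : ι → β → γ)
    (hs : ∀ x y, x ≠ y → ((univ.filter fun i => H i x = H i y).card : ℝ) ≤ s) (S : Finset β) :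
    (Nat.card {i // ¬ Set.InjOn (H i) ↑S} : ℝ) ≤ s * S.card.choose 2 := by
  classical
  rw [Nat.card_eq_fintype_card, Fintype.card_subtype]
  have hcover : (univ.filter fun i => ¬ Set.InjOn (H i) ↑S) ⊆
      (S.powersetCard 2).biUnion fun T => univ.filter fun i => ¬ Set.InjOn (H i) ↑T := by
    intro i hi
    rw [mem_filter, Set.InjOn] at hi
    push Not at hi
    obtain ⟨-, x, hx, y, hy, hxy, hne⟩ := hi
    simp only [mem_biUnion, mem_powersetCard, mem_filter, mem_univ, true_and]
    refine ⟨{x, y}, ⟨?_, card_pair hne⟩, fun hinj => hne (hinj ?_ ?_ hxy)⟩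
    · intro z hz
      rcases mem_insert.1 hz with rfl | hz
      · exact hx
      · exact (mem_singleton.1 hz) ▸ hy
    · simp
    · simp
  have hpair : ∀ T ∈ S.powersetCard 2,
      ((univ.filter fun i => ¬ Set.InjOn (H i) ↑T).card : ℝ) ≤ s := by
    intro T hT
    obtain ⟨x, y, hne, rfl⟩ := card_eq_two.1 (mem_powersetCard.1 hT).2
    refine le_trans ?_ (hs x y hne)
    gcongr with i
    intro h
    contrapose! h
    simp [Set.injOn_pair, h]
  calc ((univ.filter fun i => ¬ Set.InjOn (H i) ↑S).card : ℝ)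
      ≤ ∑ T ∈ S.powersetCard 2, ((univ.filter fun i => ¬ Set.InjOn (H i) ↑T).card : ℝ) := by
        exact_mod_cast (card_le_card hcover).trans card_biUnion_le
    _ ≤ ∑ T ∈ S.powersetCard 2, s := sum_le_sum hpair
    _ = s * S.card.choose 2 := by rw [sum_const, card_powersetCard, nsmul_eq_mul, mul_comm]

open Finset in
/-- Gilbert–Varshamov type existence of `n` words of length `N` over a `q`-letter alphabet that
pairwise agree in at most `a * N` coordinates. -/
lemma exists_words_agree_le {q n N : ℕ} {a : ℝ} (hq : 0 < q) (ha : 1 ≤ a * q)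
    (hN : Real.log n < N * ((a * q - 1) ^ 2 / (2 * a * q ^ 2))) (hn : 0 < n) :
    ∃ c : Fin n → Fin N → Fin q, ∀ i j, i ≠ j →
      ((univ.filter fun k => c i k = c j k).card : ℝ) ≤ a * N := by
  have : Nonempty (Fin q) := ⟨⟨0, hq⟩⟩
  have hq' : (0 : ℝ) < q := by exact_mod_cast hq
  have hn' : (0 : ℝ) < n := by exact_mod_cast hn
  have haq : 0 < a * q := by linarith
  have ha0 : 0 < a := pos_of_mul_pos_left haq hq'.le
  have hcount (x : Fin N → Fin q) := card_agree_gt_le x (Real.log_nonneg ha) (a * N)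
  simp only [Fintype.card_fin, Real.exp_log haq] at hcount
  have hexp : Real.log n + (N * ((a * q - 1) / q) - Real.log (a * q) * (a * N)) < 0 := by
    have h := add_sq_half_le_neg_log_one_sub (v := 1 - 1 / (a * q))
      (by rw [sub_nonneg, div_le_one haq]; exact ha) (by have := one_div_pos.2 haq; linarith)
    rw [sub_sub_cancel, one_div, Real.log_inv, neg_neg] at h
    have h2 := mul_le_mul_of_nonneg_left h (mul_nonneg ha0.le (Nat.cast_nonneg (α := ℝ) N))
    have h3 : a * N * (1 - (a * q)⁻¹ + (1 - (a * q)⁻¹) ^ 2 / 2) =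
        N * ((a * q - 1) / q) + N * ((a * q - 1) ^ 2 / (2 * a * q ^ 2)) := by
      field_simp
    rw [h3] at h2
    linarith
  obtain ⟨c, hc⟩ := exists_pairwise_of_card_conflict_lt
    (fun x y : Fin N → Fin q => a * N < ((univ.filter fun k => x k = y k).card : ℝ))
    (fun x y h => by simpa only [eq_comm] using h) (by positivity) hcount n (by
      have h : (n : ℝ) * Real.exp (N * ((a * q - 1) / q) - Real.log (a * q) * (a * N)) < 1 := by
        rw [← Real.exp_lt_exp, Real.exp_add, Real.exp_log hn', Real.exp_zero] at hexp
        exact hexp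
      have hqN : (0 : ℝ) < (q : ℝ) ^ N := by positivity
      simp only [Fintype.card_pi, Fintype.card_fin, prod_const, card_univ]
      push_cast
      nlinarith)
  exact ⟨c, fun i j hij => not_lt.1 (hc i j hij)⟩


/-- Let `q` be a prime power, `0 < ε < 1`, `d ≥ 2` and `n` integers with `n > q`, and
set `D = d(d−1)/2 + 1`.  If `D/ε + 1 ≤ q ≤ 4D/ε` then there exists a `(1−ε)`-dense
`(n,q,d)`-perfect hash family of size at most
`⌈4(q−1)²·D·ln(q(n+1)) / ((q − D/ε)²·ε)⌉`: a finite family `H` (a finite sequence,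
counted with multiplicity) of functions `[n] → [q]` such that for every subset
`S ⊆ [n]` with `|S| = d`, at least `(1−ε)|H|` of the functions `h ∈ H` are injective
on `S`. -/
theorem exists_dense_PHF_small_q (q d n : ℕ) (hq : IsPrimePow q) (ε : ℝ)
    (hε0 : 0 < ε) (hε1 : ε < 1) (hd : 2 ≤ d) (hn : n > q)
    (D : ℕ) (hD : D = d * (d - 1) / 2 + 1)
    (hq1 : (D : ℝ) / ε + 1 ≤ (q : ℝ)) (hq2 : (q : ℝ) ≤ 4 * (D : ℝ) / ε) :
    ∃ (N : ℕ) (H : Fin N → (Fin n → Fin q)),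
      0 < N ∧
      N ≤
        ⌈4 * ((q : ℝ) - 1) ^ 2 * (D : ℝ) * Real.log (q * (n + 1)) /
          (((q : ℝ) - (D : ℝ) / ε) ^ 2 * ε)⌉₊ ∧
      ∀ S : Finset (Fin n), S.card = d →
        (1 - ε) * N ≤ (Nat.card {i : Fin N // Set.InjOn (H i) ↑S} : ℝ) := by
  have hD2 : (2 : ℝ) ≤ D := by
    have : 1 ≤ d * (d - 1) / 2 := by
      rw [Nat.le_div_iff_mul_le two_pos]
      obtain ⟨e, rfl⟩ := Nat.exists_eq_add_of_le hd
      rw [show 2 + e - 1 = e + 1 by omega]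
      nlinarith
    exact_mod_cast (by omega : 2 ≤ D)
  have hq4 : (4 : ℝ) ≤ q := by
    have h : (D : ℝ) < D / ε := by rw [lt_div_iff₀ hε0]; nlinarith
    have : (3 : ℝ) < q := by linarith
    exact_mod_cast (by exact_mod_cast this : 3 < q)
  have hn0 : 0 < n := by omega
  have hn1 : (1 : ℝ) ≤ n := by exact_mod_cast hn0
  have hgap : 0 < (q : ℝ) - D / ε := by linarith
  have hlog : Real.log n < Real.log (q * (n + 1)) :=
    Real.log_lt_log (by linarith) (by nlinarith)
  have hlog0 : 0 ≤ Real.log n := Real.log_nonneg hn1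
  set X : ℝ := 4 * ((q : ℝ) - 1) ^ 2 * (D : ℝ) * Real.log (q * (n + 1)) /
    (((q : ℝ) - (D : ℝ) / ε) ^ 2 * ε) with hX
  have hXN : X ≤ ⌈X⌉₊ := Nat.le_ceil X
  have hXpos : 0 < X := by
    have : 0 < (q : ℝ) - 1 := by linarith
    have : 0 < Real.log (q * (n + 1)) := by linarith
    positivity
  have haq : 1 ≤ ε / D * q := by
    have : (D : ℝ) / ε ≤ q := by linarith
    rw [div_le_iff₀ hε0] at this
    rw [div_mul_eq_mul_div, le_div_iff₀ (by linarith)]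
    linarith
  have hrate : Real.log n <
      ⌈X⌉₊ * ((ε / D * q - 1) ^ 2 / (2 * (ε / D) * q ^ 2)) := by
    have hXrate : X * ((ε / D * q - 1) ^ 2 / (2 * (ε / D) * q ^ 2)) =
        2 * (q - 1) ^ 2 / q ^ 2 * Real.log (q * (n + 1)) := by
      have h1 : ε / D * q - 1 = ε / D * (q - D / ε) := by field_simp
      rw [hX, h1]
      generalize (q : ℝ) - D / ε = g at hgap ⊢
      field_simp
      ring
    have hfac : 1 ≤ 2 * ((q : ℝ) - 1) ^ 2 / q ^ 2 := by
      rw [one_le_div (by positivity)]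
      nlinarith
    calc Real.log n < Real.log (q * (n + 1)) := hlog
      _ ≤ 2 * (q - 1) ^ 2 / q ^ 2 * Real.log (q * (n + 1)) :=
        le_mul_of_one_le_left (by linarith) hfac
      _ ≤ _ := by rw [← hXrate]; gcongr
  obtain ⟨c, hc⟩ := exists_words_agree_le hq.pos haq hrate hn0
  refine ⟨⌈X⌉₊, fun k i => c i k, Nat.ceil_pos.2 hXpos, le_rfl, fun S hS => ?_⟩
  have hbad := card_not_injOn_le (fun k i => c i k) hc S
  rw [hS, Nat.choose_two_right] at hbad
  have hDd : ((d * (d - 1) / 2 : ℕ) : ℝ) ≤ D := by exact_mod_cast (by omega)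
  have hbound : ε / D * (⌈X⌉₊ : ℝ) * ((d * (d - 1) / 2 : ℕ) : ℝ) ≤ ε * ⌈X⌉₊ := by
    calc _ ≤ ε / D * (⌈X⌉₊ : ℝ) * D := by gcongr
      _ = ε * ⌈X⌉₊ := by field_simp
  have hsplit : (Nat.card {k : Fin ⌈X⌉₊ // Set.InjOn (fun i => c i k) ↑S} : ℝ) +
      Nat.card {k : Fin ⌈X⌉₊ // ¬ Set.InjOn (fun i => c i k) ↑S} = ⌈X⌉₊ := by
    classical
    have h := Fintype.card_subtype_compl fun k : Fin ⌈X⌉₊ => Set.InjOn (fun i => c i k) ↑S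
    have h' := Fintype.card_subtype_le fun k : Fin ⌈X⌉₊ => Set.InjOn (fun i => c i k) ↑S
    rw [Fintype.card_fin] at h h'
    simp only [Nat.card_eq_fintype_card]
    exact_mod_cast (by omega)
  linarith
end

section
/- There exists an absolute constant C > 0 such that for every integer d ≥ 2, every prime power q with q ≥ d, and every integer n ≥ 4 with d ≤ log n / (8·log log n), there exists an (n,q,d)-perfect hash family of size at most C · d³ · log n / g(q,d). -/
/-- Greedy covering: if every `b` is covered by at least a `g`-fraction of the `a`'s, then `k`
choices of `a` leave at most a `(1 - g) ^ k`-fraction of `T` uncovered. -/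
theorem exists_finset_card_uncovered_le {α β : Type*} [Fintype α] [Nonempty α] [DecidableEq α]
    (R : α → β → Prop) [∀ a b, Decidable (R a b)] {g : ℝ} (hg : g ≤ 1) (T : Finset β)
    (hR : ∀ b ∈ T, g * Fintype.card α ≤ ((Finset.univ.filter fun a => R a b).card : ℝ)) (k : ℕ) :
    ∃ H : Finset α, H.card ≤ k ∧
      ((T.filter fun b => ∀ a ∈ H, ¬ R a b).card : ℝ) ≤ T.card * (1 - g) ^ k := by
  induction k with
  | zero => exact ⟨∅, by simp⟩
  | succ k ih =>
    obtain ⟨H, hHk, hH⟩ := ih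
    set U := T.filter fun b => ∀ a ∈ H, ¬ R a b with hU
    have hsum : ∑ _a : α, g * (U.card : ℝ) ≤ ∑ a : α, ((U.filter fun b => R a b).card : ℝ) := by
      calc ∑ _a : α, g * (U.card : ℝ) = ∑ _b ∈ U, g * Fintype.card α := by
            simp only [Finset.sum_const, Finset.card_univ, nsmul_eq_mul]; ring
        _ ≤ ∑ b ∈ U, ((Finset.univ.filter fun a => R a b).card : ℝ) :=
            Finset.sum_le_sum fun b hb => hR b (Finset.mem_of_mem_filter b hb)
        _ = ∑ a : α, ((U.filter fun b => R a b).card : ℝ) := by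
            exact_mod_cast (Finset.sum_card_bipartiteAbove_eq_sum_card_bipartiteBelow
              (s := Finset.univ) (t := U) R).symm
    obtain ⟨a, -, ha⟩ := Finset.exists_le_of_sum_le Finset.univ_nonempty hsum
    refine ⟨insert a H, (Finset.card_insert_le a H).trans (by omega), ?_⟩
    have hfilter : (T.filter fun b => ∀ a' ∈ insert a H, ¬ R a' b)
        = U.filter fun b => ¬ R a b := by
      ext b
      simp only [hU, Finset.mem_filter, Finset.forall_mem_insert]
      tauto
    have hsplit : ((U.filter fun b => R a b).card : ℝ) + (U.filter fun b => ¬ R a b).card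
        = U.card := by
      exact_mod_cast Finset.card_filter_add_card_filter_not (s := U) fun b => R a b
    rw [hfilter, pow_succ]
    nlinarith [mul_le_mul_of_nonneg_right hH (sub_nonneg.mpr hg)]

/-- The number of functions `Fin n → Fin q` that are injective on `S`. -/
theorem card_filter_injOn {n q : ℕ} (S : Finset (Fin n))
    [DecidablePred fun h : Fin n → Fin q => Set.InjOn h ↑S] :
    (Finset.univ.filter fun h : Fin n → Fin q => Set.InjOn h ↑S).card
      = q.descFactorial S.card * q ^ (n - S.card) := by
  classical
  let e := Equiv.piEquivPiSubtypeProd (fun x => x ∈ S) (fun _ : Fin n => Fin q)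
  let e₁ : {h : Fin n → Fin q // Set.InjOn h ↑S} ≃
      {p : ({x // x ∈ S} → Fin q) × ({x // x ∉ S} → Fin q) // Function.Injective p.1} :=
    e.subtypeEquiv fun h => Set.injOn_iff_injective
  let e₂ : {p : ({x // x ∈ S} → Fin q) × ({x // x ∉ S} → Fin q) // Function.Injective p.1} ≃
      ({x // x ∈ S} ↪ Fin q) × ({x // x ∉ S} → Fin q) :=
    { toFun := fun p => (⟨p.1.1, p.2⟩, p.1.2)
      invFun := fun p => ⟨(p.1, p.2), p.1.injective⟩
      left_inv := fun _ => rfl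
      right_inv := fun _ => rfl }
  rw [← Fintype.card_subtype, Fintype.card_congr (e₁.trans e₂), Fintype.card_prod,
    Fintype.card_embedding_eq, Fintype.card_fun]
  simp [Fintype.card_subtype_compl]

theorem prod_one_sub_div_mul_pow {d q : ℕ} (hq : 0 < q) (hdq : d ≤ q) :
    (∏ i ∈ Finset.range d, (1 - (i : ℝ) / q)) * (q : ℝ) ^ d = q.descFactorial d := by
  have hpow : (q : ℝ) ^ d = ∏ _i ∈ Finset.range d, (q : ℝ) := by simp
  rw [hpow, ← Finset.prod_mul_distrib, Nat.descFactorial_eq_prod_range, Nat.cast_prod]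
  refine Finset.prod_congr rfl fun i hi => ?_
  have hi' := Finset.mem_range.mp hi
  have hq' : (q : ℝ) ≠ 0 := by positivity
  rw [Nat.cast_sub (by omega)]
  field_simp


/-- There exists an absolute constant `C > 0` such that for every integer `d ≥ 2`,
every prime power `q ≥ d`, and every integer `n ≥ 4` with
`d ≤ log n / (8·log log n)` (base-2 logarithms), there exists an `(n,q,d)`-perfect
hash family of size at most `C·d³·log n / g(q,d)`, where
`g(q,d) = (1 − 1/q)(1 − 2/q)···(1 − (d−1)/q)`. -/
theorem exists_PHF_small_d :
    ∃ C : ℝ, C > 0 ∧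
      ∀ d q n : ℕ, 2 ≤ d → IsPrimePow q → q ≥ d → 4 ≤ n →
        (d : ℝ) ≤ Real.logb 2 n / (8 * Real.logb 2 (Real.logb 2 n)) →
        ∃ H : Finset (Fin n → Fin q),
          (∀ S : Finset (Fin n), S.card = d → ∃ h ∈ H, Set.InjOn h ↑S) ∧
          (H.card : ℝ) ≤
            C * (d : ℝ) ^ 3 * Real.logb 2 n /
              (∏ i ∈ Finset.range d, (1 - (i : ℝ) / (q : ℝ))) := by
  classical
  refine ⟨2, two_pos, fun d q n hd _ hdq hn _ => ?_⟩
  have hq : 0 < q := by omega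
  set g := ∏ i ∈ Finset.range d, (1 - (i : ℝ) / (q : ℝ)) with hgdef
  have hq' : (0 : ℝ) < q := by exact_mod_cast hq
  have hg0 : 0 < g := by
    refine Finset.prod_pos fun i hi => ?_
    have hi' : (i : ℝ) < q := by exact_mod_cast (Finset.mem_range.mp hi).trans_le hdq
    rw [sub_pos, div_lt_one hq']
    exact hi'
  have hg1 : g ≤ 1 := by
    refine Finset.prod_le_one (fun i hi => ?_) fun i _ => sub_le_self _ (by positivity)
    have hi' : (i : ℝ) ≤ q := by exact_mod_cast ((Finset.mem_range.mp hi).trans_le hdq).le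
    rw [sub_nonneg, div_le_one hq']
    exact hi'
  have hn' : (4 : ℝ) ≤ n := by exact_mod_cast hn
  have hlog : 0 < Real.log n := Real.log_pos (by linarith)
  have hlogb : (2 : ℝ) ≤ Real.logb 2 n := by
    rw [Real.le_logb_iff_rpow_le one_lt_two (by linarith)]
    norm_num
    exact hn
  have hlog_le : Real.log n ≤ Real.logb 2 n :=
    le_div_self hlog.le (Real.log_pos one_lt_two)
      (Real.log_two_lt_d9.le.trans (by norm_num))
  set k := ⌊(d : ℝ) * Real.log n / g⌋₊ + 1 with hk
  have : Nonempty (Fin n → Fin q) := ⟨fun _ => ⟨0, hq⟩⟩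
  obtain ⟨H, hHk, hH⟩ := exists_finset_card_uncovered_le
    (fun (h : Fin n → Fin q) (S : Finset (Fin n)) => Set.InjOn h ↑S) hg1
    (Finset.univ.powersetCard d) (fun S hS => by
      have hSd := (Finset.mem_powersetCard.mp hS).2
      have hdn : d ≤ n := by simpa [hSd] using Finset.card_le_univ S
      rw [card_filter_injOn, hSd, Nat.cast_mul, ← prod_one_sub_div_mul_pow hq hdq, ← hgdef,
        mul_assoc]
      push_cast [Fintype.card_fun, Fintype.card_fin]
      rw [← pow_add, Nat.add_sub_cancel' hdn]) k
  refine ⟨H, fun S hS => ?_, ?_⟩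
  · have hlt : ((Finset.univ.powersetCard d : Finset (Finset (Fin n))).card : ℝ)
        * (1 - g) ^ k < 1 := by
      have hchoose : ((Finset.univ.powersetCard d : Finset (Finset (Fin n))).card : ℝ)
          ≤ Real.exp (d * Real.log n) := by
        rw [Finset.card_powersetCard, Finset.card_univ, Fintype.card_fin, Real.exp_nat_mul,
          Real.exp_log (by linarith)]
        exact_mod_cast Nat.choose_le_pow n d
      have hpow : (1 - g) ^ k ≤ Real.exp (-(k * g)) := by
        rw [← mul_neg, Real.exp_nat_mul]
        exact pow_le_pow_left₀ (sub_nonneg.mpr hg1) (Real.one_sub_le_exp_neg g) k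
      have hkg : (d : ℝ) * Real.log n < k * g := by
        rw [← div_lt_iff₀ hg0, hk]
        exact_mod_cast Nat.lt_floor_add_one _
      calc _ ≤ Real.exp (d * Real.log n) * Real.exp (-(k * g)) :=
            mul_le_mul hchoose hpow (pow_nonneg (sub_nonneg.mpr hg1) k) (Real.exp_pos _).le
        _ < 1 := by rw [← Real.exp_add, Real.exp_lt_one_iff]; linarith
    by_contra! hcon
    have hpos : 0 < ((Finset.univ.powersetCard d).filter fun S : Finset (Fin n) =>
        ∀ h ∈ H, ¬ Set.InjOn h ↑S).card :=
      Finset.card_pos.mpr ⟨S, by simpa [hS] using hcon⟩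
    have hone := hH.trans_lt hlt
    norm_cast at hone
    omega
  · have hd' : (2 : ℝ) ≤ d := by exact_mod_cast hd
    have hcube : (d : ℝ) ≤ (d : ℝ) ^ 3 := le_self_pow₀ (by linarith) (by norm_num)
    have hHk' : (H.card : ℝ) ≤ k := by exact_mod_cast hHk
    have hfloor : (k : ℝ) ≤ (d : ℝ) * Real.log n / g + 1 := by
      rw [hk]
      push_cast
      gcongr
      exact Nat.floor_le (by positivity)
    refine hHk'.trans (hfloor.trans ?_)
    rw [div_add_one hg0.ne']
    gcongr
    nlinarith [mul_le_mul hcube hlog_le hlog.le (by positivity)]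
end

section
/- Let d ≥ 2 be an integer and q an integer with q > d²/2, and let ε ≥ 0 satisfy ε ≤ d(d−1)/(2q) − d²(d−1)²/(8q²). Then there exists n₀ such that for all n ≥ n₀ there is no (1−ε)-dense (n,q,d)-perfect hash family. -/
open Finset in
/-- The sum over all `k`-element subsets of `s` of the product of the values of `x`. -/
def elemSym {ι : Type*} (x : ι → ℝ) (s : Finset ι) (k : ℕ) : ℝ :=
  ∑ T ∈ s.powersetCard k, ∏ i ∈ T, x i

namespace elemSym

open Finset

variable {ι : Type*} {x : ι → ℝ}

lemma zero_right (x : ι → ℝ) (s : Finset ι) : elemSym x s 0 = 1 := by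
  simp [elemSym]

lemma nonneg (hx : ∀ i, 0 ≤ x i) (s : Finset ι) (k : ℕ) : 0 ≤ elemSym x s k :=
  sum_nonneg fun _ _ => prod_nonneg fun i _ => hx i

variable [DecidableEq ι]

lemma insert_succ (x : ι → ℝ) {s : Finset ι} {a : ι} (ha : a ∉ s) (k : ℕ) :
    elemSym x (insert a s) (k + 1) = elemSym x s (k + 1) + x a * elemSym x s k := by
  have hmem : ∀ T ∈ s.powersetCard k, a ∉ T := fun T hT h =>
    ha ((mem_powersetCard.mp hT).1 h)
  unfold elemSym
  rw [powersetCard_succ_insert ha, sum_union, sum_image, mul_sum]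
  · exact congrArg _ (sum_congr rfl fun T hT => prod_insert (hmem T hT))
  · intro T hT U hU h
    rw [← erase_insert (hmem T hT), h, erase_insert (hmem U hU)]
  · refine disjoint_left.mpr fun T hT hT' => ?_
    obtain ⟨U, -, rfl⟩ := mem_image.mp hT'
    exact ha ((mem_powersetCard.mp hT).1 (mem_insert_self a U))

lemma eq_erase_add (x : ι → ℝ) {s : Finset ι} {a : ι} (ha : a ∈ s) (k : ℕ) :
    elemSym x s (k + 1) = elemSym x (s.erase a) (k + 1) + x a * elemSym x (s.erase a) k := by
  conv_lhs => rw [← insert_erase ha]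
  exact insert_succ x (notMem_erase a s) k

lemma sum_erase (x : ι → ℝ) (s : Finset ι) (k : ℕ) :
    ∑ i ∈ s, elemSym x (s.erase i) k = ((s.card : ℝ) - k) * elemSym x s k := by
  have h (i : ι) : (s.erase i).powersetCard k = (s.powersetCard k).filter (i ∉ ·) := by
    ext T
    simp only [mem_powersetCard, mem_filter, subset_erase]
    tauto
  simp_rw [elemSym, h, sum_filter]
  rw [sum_comm, mul_sum]
  refine sum_congr rfl fun T hT => ?_
  obtain ⟨hTs, hTk⟩ := mem_powersetCard.mp hT
  rw [← sum_filter, sum_const, nsmul_eq_mul, ← sdiff_eq_filter, card_sdiff_of_subset hTs,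
    Nat.cast_sub (card_le_card hTs), hTk]

lemma sum_mul_erase (x : ι → ℝ) (s : Finset ι) (k : ℕ) :
    ∑ i ∈ s, x i * elemSym x (s.erase i) k = (k + 1) * elemSym x s (k + 1) := by
  have h := sum_erase x s (k + 1)
  have h' : ∑ i ∈ s, x i * elemSym x (s.erase i) k =
      ∑ i ∈ s, (elemSym x s (k + 1) - elemSym x (s.erase i) (k + 1)) :=
    sum_congr rfl fun i hi => by rw [eq_erase_add x hi]; ring
  rw [h', sum_sub_distrib, h, sum_const, nsmul_eq_mul]
  push_cast
  ring

lemma antivaryOn_erase (hx : ∀ i, 0 ≤ x i) (s : Finset ι) (k : ℕ) :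
    AntivaryOn x (fun i => elemSym x (s.erase i) k) s := by
  intro i hi j hj hij
  by_contra! hlt
  cases k with
  | zero => simp [zero_right] at hij
  | succ k =>
    have hne : i ≠ j := by rintro rfl; exact lt_irrefl _ hlt
    have h1 := eq_erase_add x (mem_erase.mpr ⟨hne.symm, hj⟩ : j ∈ s.erase i) k
    have h2 := eq_erase_add x (mem_erase.mpr ⟨hne, hi⟩ : i ∈ s.erase j) k
    rw [erase_right_comm] at h2
    have := mul_le_mul_of_nonneg_right hlt.le (nonneg hx ((s.erase i).erase j) k)
    simp only at hij
    linarith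

/-- The step of Maclaurin's inequality, by Chebyshev's sum inequality. -/
lemma card_mul_succ_le (hx : ∀ i, 0 ≤ x i) (s : Finset ι) (k : ℕ) :
    s.card * ((k + 1) * elemSym x s (k + 1)) ≤
      (∑ i ∈ s, x i) * (((s.card : ℝ) - k) * elemSym x s k) := by
  rw [← sum_mul_erase, ← sum_erase]
  exact (antivaryOn_erase hx s k).card_mul_sum_le_sum_mul_sum

/-- **Maclaurin's inequality** between the elementary symmetric functions of degree `1`
and `d`. -/
lemma maclaurin (hx : ∀ i, 0 ≤ x i) (s : Finset ι) {d : ℕ} (hd : d ≤ s.card) :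
    (s.card : ℝ) ^ d * (d.factorial * elemSym x s d) ≤
      (∑ i ∈ s, x i) ^ d * ∏ k ∈ range d, ((s.card : ℝ) - k) := by
  induction d with
  | zero => simp [zero_right]
  | succ d ih =>
    have hsum : 0 ≤ ∑ i ∈ s, x i := sum_nonneg fun i _ => hx i
    have hd' : (0 : ℝ) ≤ (s.card : ℝ) - d := by
      rw [sub_nonneg]; exact_mod_cast (Nat.le_succ d).trans hd
    calc (s.card : ℝ) ^ (d + 1) * ((d + 1).factorial * elemSym x s (d + 1))
        = (s.card : ℝ) ^ d * d.factorial *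
            (s.card * ((d + 1) * elemSym x s (d + 1))) := by
          rw [Nat.factorial_succ]; push_cast; ring
      _ ≤ (s.card : ℝ) ^ d * d.factorial *
            ((∑ i ∈ s, x i) * (((s.card : ℝ) - d) * elemSym x s d)) := by
          exact mul_le_mul_of_nonneg_left (card_mul_succ_le hx s d) (by positivity)
      _ = (s.card : ℝ) ^ d * (d.factorial * elemSym x s d) *
            ((∑ i ∈ s, x i) * ((s.card : ℝ) - d)) := by ring
      _ ≤ ((∑ i ∈ s, x i) ^ d * ∏ k ∈ range d, ((s.card : ℝ) - k)) *
            ((∑ i ∈ s, x i) * ((s.card : ℝ) - d)) :=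
          mul_le_mul_of_nonneg_right (ih ((Nat.le_succ d).trans hd)) (mul_nonneg hsum hd')
      _ = _ := by rw [prod_range_succ]; ring

end elemSym

section InjOnCount

open Finset

open scoped Classical in
lemma card_injOn_le_elemSym {α β : Type*} [Fintype α] [Fintype β] [DecidableEq β]
    (h : α → β) (d : ℕ) :
    (((univ.powersetCard d).filter fun S : Finset α => Set.InjOn h S).card : ℝ) ≤
      elemSym (fun b => ((univ.filter fun a => h a = b).card : ℝ)) univ d := by
  have hsub : ((univ.powersetCard d).filter fun S : Finset α => Set.InjOn h S) ⊆
      (univ.powersetCard d).biUnion fun T : Finset β =>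
        (T.pi fun b => univ.filter fun a => h a = b).image
          fun f => T.attach.image fun b => f b.1 b.2 := by
    intro S hS
    obtain ⟨hS, hinj⟩ := mem_filter.mp hS
    have hSd := (mem_powersetCard.mp hS).2
    have hex (b : β) (hb : b ∈ S.image h) : ∃ a ∈ S, h a = b := mem_image.mp hb
    choose f hfS hf using hex
    refine mem_biUnion.mpr ⟨S.image h, mem_powersetCard.mpr ⟨subset_univ _, ?_⟩,
      mem_image.mpr ⟨f, mem_pi.mpr fun b hb => by simpa using hf b hb, ?_⟩⟩
    · rw [card_image_of_injOn hinj, hSd]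
    · ext a
      simp only [mem_image, mem_attach, true_and, Subtype.exists]
      constructor
      · rintro ⟨b, hb, rfl⟩
        exact hfS b (mem_image.mpr hb)
      · intro ha
        have hb := mem_image_of_mem h ha
        exact ⟨h a, mem_image.mp hb, hinj (hfS _ hb) ha (hf _ hb)⟩
  have hcard := (card_le_card hsub).trans card_biUnion_le
  have hle : ((univ.powersetCard d).filter fun S : Finset α => Set.InjOn h S).card ≤
      ∑ T ∈ (univ : Finset β).powersetCard d, ∏ b ∈ T, (univ.filter fun a => h a = b).card :=
    hcard.trans (sum_le_sum fun T _ => card_image_le.trans (card_pi _ _).le)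
  simp only [elemSym]
  exact_mod_cast hle

open scoped Classical in
lemma card_injOn_mul_le {n q d : ℕ} (h : Fin n → Fin q) (hdq : d ≤ q) :
    (q : ℝ) ^ d * (d.factorial *
      ((univ.powersetCard d).filter fun S : Finset (Fin n) => Set.InjOn h S).card) ≤
      (n : ℝ) ^ d * ∏ k ∈ range d, ((q : ℝ) - k) := by
  have hmac := elemSym.maclaurin (x := fun b => ((univ.filter fun a => h a = b).card : ℝ))
    (fun _ => Nat.cast_nonneg _) univ (d := d) (by simpa using hdq)
  have hsum : ∑ b, ((univ.filter fun a => h a = b).card : ℝ) = n := by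
    rw [← Nat.cast_sum, ← card_eq_sum_card_fiberwise fun _ _ => mem_univ _]
    simp
  rw [hsum, card_univ, Fintype.card_fin] at hmac
  refine le_trans ?_ hmac
  gcongr
  exact card_injOn_le_elemSym h d

lemma factorial_mul_choose_eq_prod {n d : ℕ} (hdn : d ≤ n) :
    (d.factorial : ℝ) * n.choose d = ∏ k ∈ range d, ((n : ℝ) - k) := by
  rw [← Nat.cast_mul, ← Nat.descFactorial_eq_factorial_mul_choose,
    Nat.descFactorial_eq_prod_range, Nat.cast_prod]
  exact prod_congr rfl fun k hk => Nat.cast_sub ((mem_range.mp hk).le.trans hdn)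

lemma prod_sub_eq (d : ℕ) {m : ℝ} (hm : m ≠ 0) :
    ∏ k ∈ range d, (m - k) = m ^ d * ∏ k ∈ range d, (1 - (k : ℝ) / m) := by
  rw [← card_range d, ← prod_const, card_range, ← prod_mul_distrib]
  exact prod_congr rfl fun k _ => by field_simp

open scoped Classical in
/-- The density of a perfect hash family is at most the ratio of the probabilities that `d`
independent uniform samples are distinct, from `q` and from `n` values. -/
lemma density_mul_prod_le {n q d N : ℕ} (hd : 0 < d) (hdq : d ≤ q) (hdn : d ≤ n) (hN : 0 < N)
    (δ : ℝ) (H : Fin N → Fin n → Fin q)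
    (hH : ∀ S : Finset (Fin n), S.card = d →
      δ * N ≤ (Nat.card {i : Fin N // Set.InjOn (H i) ↑S} : ℝ)) :
    δ * ∏ k ∈ range d, (1 - (k : ℝ) / n) ≤ ∏ k ∈ range d, (1 - (k : ℝ) / q) := by
  have hn0 : (0 : ℝ) < n := by exact_mod_cast hd.trans_le hdn
  have hq0 : (0 : ℝ) < q := by exact_mod_cast hd.trans_le hdq
  have hN0 : (0 : ℝ) < N := by exact_mod_cast hN
  have hcount : (n.choose d : ℝ) * (δ * N) ≤ ∑ i : Fin N,
      (((univ.powersetCard d).filter fun S : Finset (Fin n) =>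
        Set.InjOn (H i) S).card : ℝ) := by
    calc (n.choose d : ℝ) * (δ * N)
        = ∑ S ∈ (univ : Finset (Fin n)).powersetCard d, δ * N := by simp
      _ ≤ ∑ S ∈ (univ : Finset (Fin n)).powersetCard d,
            ((univ.filter fun i : Fin N => Set.InjOn (H i) S).card : ℝ) :=
          sum_le_sum fun S hS => by
            simpa [Nat.card_eq_fintype_card, Fintype.card_subtype] using
              hH S (mem_powersetCard.mp hS).2
      _ = _ := by
          exact_mod_cast sum_card_bipartiteAbove_eq_sum_card_bipartiteBelow _
  have hmul : (q : ℝ) ^ d * (d.factorial * ((n.choose d : ℝ) * (δ * N))) ≤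
      N * ((n : ℝ) ^ d * ∏ k ∈ range d, ((q : ℝ) - k)) := by
    calc (q : ℝ) ^ d * (d.factorial * ((n.choose d : ℝ) * (δ * N)))
        ≤ (q : ℝ) ^ d * (d.factorial * ∑ i : Fin N,
            (((univ.powersetCard d).filter fun S : Finset (Fin n) =>
              Set.InjOn (H i) S).card : ℝ)) := by gcongr
      _ = ∑ i : Fin N, (q : ℝ) ^ d * (d.factorial *
            (((univ.powersetCard d).filter fun S : Finset (Fin n) =>
              Set.InjOn (H i) S).card : ℝ)) := by simp_rw [mul_sum]
      _ ≤ ∑ _i : Fin N, (n : ℝ) ^ d * ∏ k ∈ range d, ((q : ℝ) - k) :=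
          sum_le_sum fun i _ => card_injOn_mul_le (H i) hdq
      _ = _ := by simp
  have hfac : (q : ℝ) ^ d * (d.factorial * ((n.choose d : ℝ) * (δ * N))) =
      (q : ℝ) ^ d * ((d.factorial * n.choose d) * (δ * N)) := by ring
  rw [hfac, factorial_mul_choose_eq_prod hdn, prod_sub_eq d hn0.ne', prod_sub_eq d hq0.ne'] at hmul
  refine le_of_mul_le_mul_left ?_ (by positivity : 0 < (N : ℝ) * (n : ℝ) ^ d * (q : ℝ) ^ d)
  linarith

lemma prod_one_sub_le_exp {d q : ℕ} (hdq : d ≤ q) :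
    ∏ k ∈ range d, (1 - (k : ℝ) / q) ≤ Real.exp (-((d : ℝ) * (d - 1) / (2 * q))) := by
  have hsum : ∑ k ∈ range d, -((k : ℝ) / q) = -((d : ℝ) * (d - 1) / (2 * q)) := by
    clear hdq
    induction d with
    | zero => simp
    | succ d ih =>
      rw [sum_range_succ, ih]
      rcases eq_or_ne (q : ℝ) 0 with hq | hq
      · simp [hq]
      · field_simp
        push_cast
        ring
  rw [← hsum, Real.exp_sum]
  refine prod_le_prod (fun k hk => ?_) fun k _ => Real.one_sub_le_exp_neg _
  have hkq : (k : ℝ) ≤ q := by exact_mod_cast (mem_range.mp hk).le.trans hdq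
  exact sub_nonneg.mpr (div_le_one_of_le₀ hkq (Nat.cast_nonneg q))

lemma exp_neg_lt_quadratic {x : ℝ} (hx : 0 < x) : Real.exp (-x) < 1 - x + x ^ 2 / 2 := by
  have h := Real.quadratic_le_exp_of_nonneg hx.le
  have hprod : 1 < (1 - x + x ^ 2 / 2) * (1 + x + x ^ 2 / 2) := by
    have : 0 < x ^ 4 := by positivity
    nlinarith
  rw [Real.exp_neg, inv_lt_iff_one_lt_mul₀ (Real.exp_pos x)]
  have hq : 0 < 1 - x + x ^ 2 / 2 := by nlinarith [sq_nonneg (x - 1)]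
  exact hprod.trans_le (by gcongr)

end InjOnCount

/-- Let `d ≥ 2` be an integer and `q` an integer with `q > d²/2`, and let `ε ≥ 0`
satisfy `ε ≤ d(d−1)/(2q) − d²(d−1)²/(8q²)`.  Then there exists `n₀` such that for all
`n ≥ n₀` there is no `(1−ε)`-dense `(n,q,d)`-perfect hash family (a finite nonempty
family `H`, counted with multiplicity, of functions `[n] → [q]` such that for every
subset `S ⊆ [n]` with `|S| = d` at least `(1−ε)|H|` of the functions of `H` are
injective on `S`). -/
theorem no_dense_PHF (d q : ℕ) (hd : 2 ≤ d) (hq : (d : ℝ) ^ 2 / 2 < (q : ℝ))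
    (ε : ℝ) (hε0 : 0 ≤ ε)
    (hε : ε ≤ (d : ℝ) * ((d : ℝ) - 1) / (2 * (q : ℝ)) -
      (d : ℝ) ^ 2 * ((d : ℝ) - 1) ^ 2 / (8 * (q : ℝ) ^ 2)) :
    ∃ n₀ : ℕ, ∀ n ≥ n₀,
      ¬ ∃ (N : ℕ) (H : Fin N → (Fin n → Fin q)),
          0 < N ∧
          ∀ S : Finset (Fin n), S.card = d →
            (1 - ε) * N ≤ (Nat.card {i : Fin N // Set.InjOn (H i) ↑S} : ℝ) := by

  have hd' : (2 : ℝ) ≤ d := by exact_mod_cast hd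
  have hdq : d ≤ q := by
    have : (d : ℝ) ≤ q := by nlinarith
    exact_mod_cast this
  have hq0 : (0 : ℝ) < q := by nlinarith
  have hlt : ∏ k ∈ Finset.range d, (1 - (k : ℝ) / q) < 1 - ε := by
    have hx : 0 < (d : ℝ) * (d - 1) / (2 * q) :=
      div_pos (mul_pos (by linarith) (by linarith)) (by positivity)
    have hsq : ((d : ℝ) * (d - 1) / (2 * q)) ^ 2 / 2 =
        (d : ℝ) ^ 2 * ((d : ℝ) - 1) ^ 2 / (8 * (q : ℝ) ^ 2) := by
      field_simp
      ring
    have := prod_one_sub_le_exp hdq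
    have := exp_neg_lt_quadratic hx
    linarith
  have hlim : Filter.Tendsto
      (fun n : ℕ => (1 - ε) * ∏ k ∈ Finset.range d, (1 - (k : ℝ) / n)) Filter.atTop
      (nhds (1 - ε)) := by
    have h := tendsto_finsetProd (Finset.range d) fun k _ =>
      (tendsto_const_div_atTop_nhds_zero_nat (k : ℝ)).const_sub 1
    simpa using h.const_mul (1 - ε)
  obtain ⟨n₀, hn₀⟩ := Filter.eventually_atTop.mp (hlim.eventually_const_lt hlt)
  refine ⟨max n₀ d, fun n hn => ?_⟩
  rintro ⟨N, H, hN, hH⟩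
  have hle := density_mul_prod_le (by omega) hdq ((le_max_right n₀ d).trans hn) hN (1 - ε) H hH
  exact absurd (hn₀ n ((le_max_left n₀ d).trans hn)) hle.not_gt
end

section
/- Let w, r ≥ 1 be integers, let q ≥ wr + 2 be a prime power, let n ≥ w + r be an integer, let S ⊆ F_q^n be a hitting set for H_{wr} over F_q, and let F ⊆ {0,1}^{F_q} be a (q,(w,r))-cover-free family (with coordinates indexed by the elements of F_q). Then the set {(f(b_1), f(b_2), ..., f(b_n)) : b = (b_1,...,b_n) ∈ S, f ∈ F} ⊆ {0,1}^n is an (n,(w,r))-cover-free family of size at most |F|·|S|. -/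
/-- Disjoint finsets `A`, `B` extend to disjoint finsets of prescribed larger cardinalities `w`, `r`
in any finite type with at least `w + r` elements. -/
theorem Finset.exists_disjoint_supersets_card_eq {α : Type*} [Fintype α] [DecidableEq α]
    {A B : Finset α} {w r : ℕ} (hA : A.card ≤ w) (hB : B.card ≤ r) (hAB : Disjoint A B)
    (hwr : w + r ≤ Fintype.card α) :
    ∃ A' B' : Finset α, A ⊆ A' ∧ B ⊆ B' ∧ A'.card = w ∧ B'.card = r ∧ Disjoint A' B' := by
  obtain ⟨A', hAA', hA'B, hA'⟩ := Finset.exists_subsuperset_card_eq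
    (Finset.subset_compl_iff_disjoint_right.2 hAB) hA (by rw [Finset.card_compl]; omega)
  obtain ⟨B', hBB', hB'A', hB'⟩ := Finset.exists_subsuperset_card_eq
    (Finset.subset_compl_iff_disjoint_left.2 (Finset.subset_compl_iff_disjoint_right.1 hA'B)) hB
    (by rw [Finset.card_compl]; omega)
  exact ⟨A', B', hAA', hBB', hA', hB', Finset.subset_compl_iff_disjoint_left.1 hB'A'⟩


/-- Let `w, r ≥ 1` be integers, `q ≥ wr + 2` a prime power, `n ≥ w + r` an integer,
`S ⊆ F_q^n` a hitting set for `H_{wr}` over `F_q`, and `F ⊆ {0,1}^{F_q}` a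
`(q,(w,r))`-cover-free family (with coordinates indexed by the elements of `F_q`,
i.e. for all disjoint `W, R ⊆ F_q` with `|W| = w` and `|R| = r` some `f ∈ F` is `1`
on `W` and `0` on `R`).  Then
`{(f(b₁),…,f(bₙ)) : b ∈ S, f ∈ F} ⊆ {0,1}^n` is an `(n,(w,r))`-cover-free family of
size at most `|F|·|S|`. -/
theorem CFF_from_hitting_set (w r q n : ℕ) (hw : 1 ≤ w) (hr : 1 ≤ r)
    (hq : IsPrimePow q) (hq2 : q ≥ w * r + 2) (hn : n ≥ w + r)
    (F : Type) [Field F] [Fintype F] [DecidableEq F] (hF : Fintype.card F = q)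
    (S : Finset (Fin n → F))
    (hS : ∀ I : Finset (Fin n × Fin n), I.card ≤ w * r → (∀ p ∈ I, p.1 ≠ p.2) →
      ∃ a ∈ S, ∀ p ∈ I, a p.1 ≠ a p.2)
    (Fam : Finset (F → Bool))
    (hFam : ∀ W R : Finset F, W.card = w → R.card = r → Disjoint W R →
      ∃ f ∈ Fam, (∀ x ∈ W, f x = true) ∧ (∀ x ∈ R, f x = false)) :
    (∀ W R : Finset (Fin n), W.card = w → R.card = r → Disjoint W R →
      ∃ a ∈ (S ×ˢ Fam).image (fun p => fun i => p.2 (p.1 i)),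
        (∀ i ∈ W, a i = true) ∧ (∀ i ∈ R, a i = false)) ∧
    ((S ×ˢ Fam).image (fun p => fun i => p.2 (p.1 i))).card ≤ Fam.card * S.card := by
  constructor
  · intro W R hW hR hWR
    obtain ⟨a, haS, ha⟩ := hS (W ×ˢ R) (by rw [Finset.card_product, hW, hR]) fun p hp =>
      Finset.disjoint_iff_ne.1 hWR _ (Finset.mem_product.1 hp).1 _ (Finset.mem_product.1 hp).2
    have h_disj : Disjoint (W.image a) (R.image a) := by
      simp only [Finset.disjoint_iff_ne, Finset.forall_mem_image]
      exact fun i hi j hj => ha (i, j) (Finset.mk_mem_product hi hj)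
    obtain ⟨W', R', hWW', hRR', hW', hR', h_disj'⟩ := Finset.exists_disjoint_supersets_card_eq
      (hW ▸ Finset.card_image_le) (hR ▸ Finset.card_image_le) h_disj
      (show w + r ≤ Fintype.card F by rw [hF]; nlinarith)
    obtain ⟨f, hf, hfW, hfR⟩ := hFam W' R' hW' hR' h_disj'
    exact ⟨_, Finset.mem_image_of_mem _ (Finset.mk_mem_product haS hf),
      fun i hi => hfW _ (hWW' (Finset.mem_image_of_mem a hi)),
      fun i hi => hfR _ (hRR' (Finset.mem_image_of_mem a hi))⟩
  · rw [mul_comm, ← Finset.card_product]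
    exact Finset.card_image_le
end

section
/- Let w, r ≥ 1 be integers and let q be a prime power with q ≥ wr + 2 and q > 4(wr + 1), and let n be an integer with n > q. Then there exists an (n,(w,r))-cover-free family of size at most C(q,w) · ⌈(wr+1)·log(q(n+1)) / log(q/(e(wr+1)))⌉, where C(q,w) denotes the binomial coefficient q choose w. -/
/-- At most a `1/q` fraction of all functions takes equal values at two distinct points. -/
theorem card_collision_mul_le {α β : Type*} [Fintype α] [DecidableEq α] [Fintype β]
    [DecidableEq β] {i j : α} (hij : i ≠ j) :
    (Finset.univ.filter fun h : α → β => h i = h j).card * Fintype.card β ≤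
      Fintype.card (α → β) := by
  rw [← Finset.card_univ (α := β), ← Finset.card_product, ← Finset.card_univ]
  refine Finset.card_le_card_of_injOn (fun p => Function.update p.1 i p.2)
    (fun _ _ => Finset.mem_coe.2 (Finset.mem_univ _)) ?_
  rintro ⟨h, c⟩ hp ⟨h', c'⟩ hp' heq
  simp only [Finset.coe_product, Set.mem_prod, Finset.mem_coe, Finset.mem_filter,
    Finset.mem_univ, true_and, and_true] at hp hp'
  have key : ∀ x, Function.update h i c x = Function.update h' i c' x := congrFun heq
  have hne : ∀ x, x ≠ i → h x = h' x := fun x hx => by simpa [hx] using key x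
  have hc : c = c' := by simpa using key i
  refine Prod.ext (funext fun x => ?_) hc
  by_cases hx : x = i
  · subst hx
    exact hp.trans ((hne j hij.symm).trans hp'.symm)
  · exact hne x hx

/-- At most a `|W||R|/q` fraction of all functions fails to separate the disjoint sets `W`, `R`. -/
theorem card_not_separating_mul_le {α β : Type*} [Fintype α] [DecidableEq α] [Fintype β]
    [DecidableEq β] {W R : Finset α} (hWR : Disjoint W R) :
    (Finset.univ.filter fun h : α → β => ∃ i ∈ W, ∃ j ∈ R, h i = h j).card * Fintype.card β ≤
      W.card * R.card * Fintype.card (α → β) := by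
  have hsub : (Finset.univ.filter fun h : α → β => ∃ i ∈ W, ∃ j ∈ R, h i = h j) ⊆
      (W ×ˢ R).biUnion fun p => Finset.univ.filter fun h : α → β => h p.1 = h p.2 := by
    intro h hh
    simp only [Finset.mem_filter, Finset.mem_univ, true_and] at hh
    obtain ⟨i, hi, j, hj, hij⟩ := hh
    simp only [Finset.mem_biUnion, Finset.mem_filter, Finset.mem_univ, true_and]
    exact ⟨(i, j), Finset.mem_product.2 ⟨hi, hj⟩, hij⟩
  calc _ ≤ (∑ p ∈ W ×ˢ R, (Finset.univ.filter fun h : α → β => h p.1 = h p.2).card) *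
        Fintype.card β :=
        Nat.mul_le_mul_right _ ((Finset.card_le_card hsub).trans Finset.card_biUnion_le)
    _ = ∑ p ∈ W ×ˢ R, (Finset.univ.filter fun h : α → β => h p.1 = h p.2).card *
        Fintype.card β := Finset.sum_mul _ _ _
    _ ≤ ∑ _p ∈ W ×ˢ R, Fintype.card (α → β) := by
        refine Finset.sum_le_sum fun p hp => card_collision_mul_le ?_
        rw [Finset.mem_product] at hp
        exact Finset.disjoint_iff_ne.1 hWR _ hp.1 _ hp.2
    _ = _ := by rw [Finset.sum_const, Finset.card_product, smul_eq_mul]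

/-- Union bound: if `n^(w+r) (wr)^N < q^N`, some `N` functions `[n] → [q]` separate every pair of
disjoint sets of sizes `w` and `r`. -/
theorem exists_separating_family {w r q n N : ℕ} (hq : 0 < q)
    (hN : n ^ (w + r) * (w * r) ^ N < q ^ N) :
    ∃ H : Fin N → Fin n → Fin q, ∀ W R : Finset (Fin n), W.card = w → R.card = r →
      Disjoint W R → ∃ k, ∀ i ∈ W, ∀ j ∈ R, H k i ≠ H k j := by
  have hQ : 0 < Fintype.card (Fin n → Fin q) := by
    rw [Fintype.card_fun, Fintype.card_fin, Fintype.card_fin]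
    exact pow_pos hq n
  by_contra hcon
  push Not at hcon
  let P : Finset (Finset (Fin n) × Finset (Fin n)) :=
    ((Finset.univ.powersetCard w) ×ˢ (Finset.univ.powersetCard r)).filter
      fun p => Disjoint p.1 p.2
  let bad : Finset (Fin n) × Finset (Fin n) → Finset (Fin n → Fin q) := fun p =>
    Finset.univ.filter fun h => ∃ i ∈ p.1, ∃ j ∈ p.2, h i = h j
  have hcover : (Finset.univ : Finset (Fin N → Fin n → Fin q)) ⊆
      P.biUnion fun p => Fintype.piFinset fun _ => bad p := by
    intro H _
    obtain ⟨W, R, hW, hR, hWR, hH⟩ := hcon H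
    rw [Finset.mem_biUnion]
    refine ⟨(W, R), by simp [P, hW, hR, hWR], ?_⟩
    simpa [bad, Fintype.mem_piFinset] using hH
  have hP : P.card ≤ n ^ (w + r) := by
    refine (Finset.card_filter_le _ _).trans ?_
    rw [Finset.card_product, Finset.card_powersetCard, Finset.card_powersetCard,
      Finset.card_univ, Fintype.card_fin, pow_add]
    exact Nat.mul_le_mul (Nat.choose_le_pow _ _) (Nat.choose_le_pow _ _)
  have hbad : ∀ p ∈ P, (bad p).card * q ≤ w * r * Fintype.card (Fin n → Fin q) := by
    intro p hp
    simp only [P, Finset.mem_filter, Finset.mem_product, Finset.mem_powersetCard] at hp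
    obtain ⟨⟨⟨_, hW⟩, _, hR⟩, hWR⟩ := hp
    have h := card_not_separating_mul_le (β := Fin q) hWR
    rw [Fintype.card_fin q, hW, hR] at h
    convert h
  have hle : Fintype.card (Fin n → Fin q) ^ N ≤ ∑ p ∈ P, (bad p).card ^ N := by
    have h := (Finset.card_le_card hcover).trans Finset.card_biUnion_le
    simpa [Fintype.card_piFinset] using h
  have hlt : Fintype.card (Fin n → Fin q) ^ N * q ^ N <
      Fintype.card (Fin n → Fin q) ^ N * q ^ N :=
    calc _ ≤ (∑ p ∈ P, (bad p).card ^ N) * q ^ N := Nat.mul_le_mul_right _ hle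
      _ = ∑ p ∈ P, ((bad p).card * q) ^ N := by
          rw [Finset.sum_mul]
          exact Finset.sum_congr rfl fun p _ => (mul_pow _ _ _).symm
      _ ≤ ∑ _p ∈ P, (w * r * Fintype.card (Fin n → Fin q)) ^ N :=
          Finset.sum_le_sum fun p hp => Nat.pow_le_pow_left (hbad p hp) N
      _ = P.card * (w * r) ^ N * Fintype.card (Fin n → Fin q) ^ N := by
          rw [Finset.sum_const, smul_eq_mul, mul_pow, mul_assoc]
      _ ≤ n ^ (w + r) * (w * r) ^ N * Fintype.card (Fin n → Fin q) ^ N := by gcongr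
      _ < q ^ N * Fintype.card (Fin n → Fin q) ^ N :=
          Nat.mul_lt_mul_of_pos_right hN (pow_pos hQ N)
      _ = _ := mul_comm _ _
  exact lt_irrefl _ hlt

/-- Composing separating functions with the indicators of all `w`-subsets of `[q]` gives a
cover-free family. -/
theorem exists_coverFree_of_separating {w r q n N : ℕ} (hq : w + r ≤ q)
    (H : Fin N → Fin n → Fin q)
    (hH : ∀ W R : Finset (Fin n), W.card = w → R.card = r → Disjoint W R →
      ∃ k, ∀ i ∈ W, ∀ j ∈ R, H k i ≠ H k j) :
    ∃ Fam : Finset (Fin n → Bool),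
      (∀ W R : Finset (Fin n), W.card = w → R.card = r → Disjoint W R →
        ∃ a ∈ Fam, (∀ i ∈ W, a i = true) ∧ (∀ i ∈ R, a i = false)) ∧
      Fam.card ≤ q.choose w * N := by
  refine ⟨((Finset.univ.powersetCard w : Finset (Finset (Fin q))) ×ˢ
    (Finset.univ : Finset (Fin N))).image fun p i => decide (H p.2 i ∈ p.1), ?_, ?_⟩
  · intro W R hW hR hWR
    obtain ⟨k, hk⟩ := hH W R hW hR hWR
    have hsub : W.image (H k) ⊆ (R.image (H k))ᶜ := by
      intro x hx
      obtain ⟨i, hi, rfl⟩ := Finset.mem_image.1 hx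
      rw [Finset.mem_compl, Finset.mem_image]
      rintro ⟨j, hj, hji⟩
      exact hk i hi j hj hji.symm
    have hcard : w ≤ ((R.image (H k))ᶜ).card := by
      have : (R.image (H k)).card ≤ r := hR ▸ Finset.card_image_le
      rw [Finset.card_compl, Fintype.card_fin]
      omega
    obtain ⟨T, hWT, hTR, hT⟩ := Finset.exists_subsuperset_card_eq hsub
      (hW ▸ Finset.card_image_le) hcard
    refine ⟨_, Finset.mem_image_of_mem _ (a := (T, k)) (by simp [hT]), fun i hi => ?_,
      fun i hi => ?_⟩
    · exact decide_eq_true (hWT (Finset.mem_image_of_mem _ hi))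
    · exact decide_eq_false fun h =>
        Finset.mem_compl.1 (hTR h) (Finset.mem_image_of_mem _ hi)
  · refine Finset.card_image_le.trans ?_
    simp

/-- The number of functions in the theorem is large enough for the union bound. -/
theorem pow_mul_pow_lt_of_le_ceil {w r q n : ℕ} (hw : 1 ≤ w) (hr : 1 ≤ r)
    (hq : 4 * (w * r + 1) < q) {N : ℕ}
    (hN : ((w : ℝ) * r + 1) * Real.log (q * (n + 1)) /
      Real.log (q / (Real.exp 1 * ((w : ℝ) * r + 1))) ≤ N) :
    n ^ (w + r) * (w * r) ^ N < q ^ N := by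
  have hwr : w + r ≤ w * r + 1 := by nlinarith
  have hs : (0 : ℝ) < (w : ℝ) * r + 1 := by positivity
  have hq' : 4 * ((w : ℝ) * r + 1) < q := by exact_mod_cast hq
  have hq0 : (0 : ℝ) < q := by linarith
  have hq1 : (1 : ℝ) ≤ q := by exact_mod_cast (by omega : 1 ≤ q)
  have he1 : (1 : ℝ) ≤ Real.exp 1 := Real.one_le_exp zero_le_one
  have he : Real.exp 1 < 3 := Real.exp_one_lt_d9.trans (by norm_num)
  have hd : 0 < Real.exp 1 * ((w : ℝ) * r + 1) := by positivity
  have hbase : 1 < q / (Real.exp 1 * ((w : ℝ) * r + 1)) := by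
    rw [one_lt_div hd]
    nlinarith
  have hn1 : (1 : ℝ) ≤ (n : ℝ) + 1 := by linarith [(Nat.cast_nonneg n : (0 : ℝ) ≤ n)]
  have hX : (n : ℝ) + 1 ≤ q * (n + 1) := le_mul_of_one_le_left (by linarith) hq1
  rw [div_le_iff₀ (Real.log_pos hbase)] at hN
  have hpow : ((q : ℝ) * (n + 1)) ^ (w * r + 1) ≤
      (q / (Real.exp 1 * ((w : ℝ) * r + 1))) ^ N := by
    rw [← Real.log_le_log_iff (by positivity) (by positivity), Real.log_pow, Real.log_pow]
    exact_mod_cast hN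
  have hlt : (n : ℝ) ^ (w + r) < ((q : ℝ) * (n + 1)) ^ (w * r + 1) :=
    calc (n : ℝ) ^ (w + r) < ((n : ℝ) + 1) ^ (w + r) :=
          pow_lt_pow_left₀ (by linarith) (Nat.cast_nonneg n) (by omega)
      _ ≤ ((n : ℝ) + 1) ^ (w * r + 1) := pow_le_pow_right₀ hn1 hwr
      _ ≤ _ := pow_le_pow_left₀ (by linarith) hX _
  have hlt' := hlt.trans_le hpow
  rw [div_pow, lt_div_iff₀ (pow_pos hd N)] at hlt'
  have hmono : ((w : ℝ) * r) ^ N ≤ (Real.exp 1 * ((w : ℝ) * r + 1)) ^ N :=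
    pow_le_pow_left₀ (by positivity) (by nlinarith) _
  have : (n : ℝ) ^ (w + r) * ((w : ℝ) * r) ^ N < (q : ℝ) ^ N :=
    (mul_le_mul_of_nonneg_left hmono (by positivity)).trans_lt hlt'
  exact_mod_cast this


/-- Let `w, r ≥ 1` be integers, `q` a prime power with `q ≥ wr + 2` and
`q > 4(wr + 1)`, and `n > q` an integer.  Then there exists an
`(n,(w,r))`-cover-free family of size at most
`C(q,w)·⌈(wr+1)·log(q(n+1)) / log(q/(e(wr+1)))⌉`: a set `F ⊆ {0,1}^n` such that for
all disjoint `W, R ⊆ [n]` with `|W| = w` and `|R| = r` there is `a ∈ F` which is `1`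
on `W` and `0` on `R`. -/
theorem exists_CFF (w r q n : ℕ) (hw : 1 ≤ w) (hr : 1 ≤ r) (hq : IsPrimePow q)
    (hq1 : q ≥ w * r + 2) (hq2 : q > 4 * (w * r + 1)) (hn : n > q) :
    ∃ Fam : Finset (Fin n → Bool),
      (∀ W R : Finset (Fin n), W.card = w → R.card = r → Disjoint W R →
        ∃ a ∈ Fam, (∀ i ∈ W, a i = true) ∧ (∀ i ∈ R, a i = false)) ∧
      Fam.card ≤
        q.choose w *
          ⌈((w : ℝ) * r + 1) * Real.log (q * (n + 1)) /
            Real.log (q / (Real.exp 1 * ((w : ℝ) * r + 1)))⌉₊ := by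
  obtain ⟨H, hH⟩ := exists_separating_family (by omega)
    (pow_mul_pow_lt_of_le_ceil (n := n) hw hr hq2 (Nat.le_ceil _))
  exact exists_coverFree_of_separating (by nlinarith) H hH
end
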